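/- arXiv:1903.10799 — 2 statements merged into one kernel-verified Lean document; each statement's English description precedes it below -/
import Mathlib

section
/- (Nikolskii, 1946) There exists a constant C such that for every function f : [−1,1] → ℝ that is Lipschitz with constant 1 and every integer n ≥ 1 there exists a real algebraic polynomial p_n of degree at most n such that for all x ∈ [−1,1]: |f(x) − p_n(x)| ≤ (π/2)·√(1−x²)/n + C·ln(n+1)/n². -/
open Real

namespace Nik

/-- modified Dirichlet kernel -/
noncomputable def EK (n : ℕ) (v : ℝ) : ℝ :=
  ∑ k ∈ Finset.range n, (cos (k * v) + cos ((k + 1 : ℕ) * v))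

/-- nodes -/
noncomputable def nd (n j : ℕ) : ℝ := j * π / n

/-- `y cot y` -/
noncomputable def qq (y : ℝ) : ℝ := cos y / sinc y

/-- the interpolating polynomial of the sawtooth -/
noncomputable def TT (n : ℕ) (u : ℝ) : ℝ :=
  1 / (4 * n) * ∑ i ∈ Finset.range n,
    ((π - nd n (2 * i)) / 2 * EK n (u - nd n (2 * i))
      + 2 * ((π - nd n (2 * i + 1)) / 2 * EK n (u - nd n (2 * i + 1)))
      + (π - nd n (2 * i + 2)) / 2 * EK n (u - nd n (2 * i + 2)))

/-- the error of the interpolation of the sawtooth -/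
noncomputable def DD (n : ℕ) (u : ℝ) : ℝ := (π - u) / 2 - TT n u

/-- quotient of the error by the sine -/
noncomputable def FF (n : ℕ) (u : ℝ) : ℝ :=
  1 / (4 * n) * ∑ i ∈ Finset.range n,
    (2 * qq ((u - nd n (2 * i + 1)) / 2) - qq ((u - nd n (2 * i)) / 2)
      - qq ((u - nd n (2 * i + 2)) / 2))

lemma EK_mul_sin (n : ℕ) (v : ℝ) : EK n v * sin (v / 2) = sin (n * v) * cos (v / 2) := by
  induction n with
  | zero => simp [EK]
  | succ n ih =>
    have h1 : EK (n + 1) v = EK n v + (cos (n * v) + cos ((n + 1 : ℕ) * v)) := by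
      simp only [EK, Finset.sum_range_succ]
    rw [h1, add_mul, ih]
    have e : ((n + 1 : ℕ) : ℝ) * v = n * v + 2 * (v / 2) := by push_cast; ring
    rw [e, sin_add, cos_add, sin_two_mul, cos_two_mul]
    have := sin_sq_add_cos_sq (v / 2)
    linear_combination (-2 * sin (n * v) * cos (v / 2)) * this

lemma EK_even (n : ℕ) (v : ℝ) : EK n (-v) = EK n v := by
  simp [EK]

lemma EK_cont (n : ℕ) : Continuous (EK n) := by
  unfold EK; fun_prop

lemma EK_periodic (n : ℕ) : Function.Periodic (EK n) (2 * π) := by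
  intro v
  unfold EK
  refine Finset.sum_congr rfl fun k _ => ?_
  have h (m : ℕ) : cos (m * (v + 2 * π)) = cos (m * v) := by
    rw [mul_add, cos_add_nat_mul_two_pi]
  rw [h, h]

lemma sum_cos_nodes (n k : ℕ) (hn : 1 ≤ n) (hk : 0 < k) (hk2 : k ≤ n) (u : ℝ) :
    ∑ j ∈ Finset.range (2 * n), cos (k * (u - nd n j)) = 0 := by
  have hn0 : (0 : ℝ) < n := by exact_mod_cast hn
  have hs : 0 < sin (k * π / (2 * n)) := by
    apply sin_pos_of_pos_of_lt_pi
    · have : (0 : ℝ) < k := by exact_mod_cast hk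
      positivity
    · rw [div_lt_iff₀ (by positivity)]
      have : (k : ℝ) ≤ n := by exact_mod_cast hk2
      nlinarith [pi_pos]
  have key (m : ℕ) : (∑ j ∈ Finset.range m, cos (k * (u - nd n j))) * (2 * sin (k * π / (2 * n)))
      = sin (k * u + k * π / (2 * n)) - sin (k * u + k * π / (2 * n) - k * nd n m) := by
    induction m with
    | zero => simp [nd]
    | succ m ih =>
      rw [Finset.sum_range_succ, add_mul, ih]
      have e1 : k * u + k * π / (2 * n) - k * nd n m = k * (u - nd n m) + k * π / (2 * n) := by ring
      have e2 : k * u + k * π / (2 * n) - k * nd n (m + 1)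
          = k * (u - nd n m) - k * π / (2 * n) := by
        unfold nd; push_cast; field_simp; ring
      rw [e1, e2, sin_add (k * (u - nd n m)), sin_sub (k * (u - nd n m))]; ring
  have h2 := key (2 * n)
  have e : k * u + k * π / (2 * n) - k * nd n (2 * n)
      = k * u + k * π / (2 * n) - k * (2 * π) := by
    unfold nd; push_cast; field_simp
  rw [e, sin_sub_nat_mul_two_pi, sub_self] at h2
  rcases mul_eq_zero.1 h2 with h | h
  · exact h
  · linarith

lemma sum_EK (n : ℕ) (hn : 1 ≤ n) (u : ℝ) :
    ∑ j ∈ Finset.range (2 * n), EK n (u - nd n j) = 2 * n := by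
  unfold EK
  rw [Finset.sum_comm]
  obtain ⟨m, rfl⟩ : ∃ m, n = m + 1 := ⟨n - 1, by omega⟩
  simp_rw [Finset.sum_add_distrib]
  have h2 : ∑ k ∈ Finset.range (m + 1), ∑ j ∈ Finset.range (2 * (m + 1)),
      cos ((k + 1 : ℕ) * (u - nd (m + 1) j)) = 0 := by
    apply Finset.sum_eq_zero
    intro k hk
    exact sum_cos_nodes _ _ hn (by omega) (by simpa using hk) u
  rw [h2, Finset.sum_range_succ']
  have h1 : ∑ k ∈ Finset.range m, ∑ j ∈ Finset.range (2 * (m + 1)),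
      cos ((k + 1 : ℕ) * (u - nd (m + 1) j)) = 0 := by
    apply Finset.sum_eq_zero
    intro k hk
    have := Finset.mem_range.1 hk
    exact sum_cos_nodes _ _ hn (by omega) (by omega) u
  rw [h1]
  simp

lemma nd_two_n (n : ℕ) (hn : 1 ≤ n) : nd n (2 * n) = 2 * π := by
  have hn0 : (0 : ℝ) < n := by exact_mod_cast hn
  unfold nd; push_cast; field_simp

lemma sum_pairs (a : ℕ → ℝ) (n : ℕ) :
    ∑ i ∈ Finset.range n, (a (2 * i) + 2 * a (2 * i + 1) + a (2 * i + 2))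
      = 2 * ∑ j ∈ Finset.range (2 * n), a j - a 0 + a (2 * n) := by
  induction n with
  | zero => simp
  | succ n ih =>
    rw [Finset.sum_range_succ, ih, show 2 * (n + 1) = 2 * n + 1 + 1 by ring,
      Finset.sum_range_succ, Finset.sum_range_succ]
    ring

lemma sum_EK' (n : ℕ) (hn : 1 ≤ n) (u : ℝ) :
    ∑ i ∈ Finset.range n, (EK n (u - nd n (2 * i)) + 2 * EK n (u - nd n (2 * i + 1))
      + EK n (u - nd n (2 * i + 2))) = 4 * n := by
  rw [sum_pairs (fun j => EK n (u - nd n j)), sum_EK n hn, nd_two_n n hn, (EK_periodic n).sub_eq]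
  simp [nd]; ring

lemma sinc_pos {y : ℝ} (h : y ∈ Set.Ioo (-π) π) : 0 < sinc y := by
  rcases lt_trichotomy y 0 with h0 | h0 | h0
  · rw [← sinc_neg, sinc_of_ne_zero (by linarith)]
    exact div_pos (sin_pos_of_pos_of_lt_pi (by linarith) (by linarith [h.1])) (by linarith)
  · simp [h0]
  · rw [sinc_of_ne_zero h0.ne']
    exact div_pos (sin_pos_of_pos_of_lt_pi h0 h.2) h0

lemma half_mul_EK (n : ℕ) (v : ℝ) (h : v / 2 ∈ Set.Ioo (-π) π) :
    v / 2 * EK n v = sin (n * v) * qq (v / 2) := by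
  have h1 := sinc_pos h
  by_cases h0 : v = 0
  · simp [h0]
  have h0' : v / 2 ≠ 0 := by positivity
  unfold qq
  rw [mul_div_assoc', eq_div_iff h1.ne', ← EK_mul_sin, sinc_of_ne_zero h0']
  field_simp

lemma sin_nd (n j : ℕ) (hn : 1 ≤ n) (u : ℝ) :
    sin (n * (u - nd n j)) = (-1) ^ j * sin (n * u) := by
  have hn0 : (0 : ℝ) < n := by exact_mod_cast hn
  have : n * (u - nd n j) = n * u - j * π := by unfold nd; field_simp
  rw [this, sin_sub_nat_mul_pi]

lemma nd_mem (n j : ℕ) (hn : 1 ≤ n) (hj : j ≤ 2 * n) {u : ℝ} (hu : u ∈ Set.Ioo 0 (2 * π)) :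
    (u - nd n j) / 2 ∈ Set.Ioo (-π) π := by
  have hn0 : (0 : ℝ) < n := by exact_mod_cast hn
  have h1 : 0 ≤ nd n j := by unfold nd; positivity
  have h2 : nd n j ≤ 2 * π := by
    rw [← nd_two_n n hn]; unfold nd
    gcongr
  constructor
  · linarith [hu.1]
  · linarith [hu.2]

lemma DD_eq (n : ℕ) (hn : 1 ≤ n) {u : ℝ} (hu : u ∈ Set.Ioo 0 (2 * π)) :
    DD n u = sin (n * u) * FF n u := by
  have hn0 : (0 : ℝ) < n := by exact_mod_cast hn
  have e1 : (π - u) / 2 = 1 / (4 * n) * ∑ i ∈ Finset.range n, (π - u) / 2 *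
      (EK n (u - nd n (2 * i)) + 2 * EK n (u - nd n (2 * i + 1))
      + EK n (u - nd n (2 * i + 2))) := by
    rw [← Finset.mul_sum, sum_EK' n hn]; field_simp
  unfold DD TT FF
  rw [e1, ← mul_sub, ← Finset.sum_sub_distrib, mul_left_comm, Finset.mul_sum (a := sin (n * u))]
  congr 1
  refine Finset.sum_congr rfl fun i hi => ?_
  have hi' := Finset.mem_range.1 hi
  have a0 := half_mul_EK n _ (nd_mem n (2 * i) hn (by omega) hu)
  have a1 := half_mul_EK n _ (nd_mem n (2 * i + 1) hn (by omega) hu)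
  have a2 := half_mul_EK n _ (nd_mem n (2 * i + 2) hn (by omega) hu)
  rw [sin_nd _ _ hn] at a0 a1 a2
  have p0 : (-1 : ℝ) ^ (2 * i) = 1 := by simp
  have p1 : (-1 : ℝ) ^ (2 * i + 1) = -1 := by simp [pow_succ]
  have p2 : (-1 : ℝ) ^ (2 * i + 2) = 1 := by simp [pow_succ]
  rw [p0] at a0
  rw [p1] at a1
  rw [p2] at a2
  linear_combination (-1) * a0 - 2 * a1 - a2

lemma qq_eq {y : ℝ} (hy : y ≠ 0) : qq y = y * cos y / sin y := by
  unfold qq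
  rw [sinc_of_ne_zero hy, div_div_eq_mul_div, mul_comm]

lemma qq_neg (y : ℝ) : qq (-y) = qq y := by
  simp [qq, sinc_neg]

lemma qq_abs (y : ℝ) : qq |y| = qq y := by
  rcases abs_choice y with h | h <;> rw [h]
  exact qq_neg y

lemma qq_hasDerivAt {y : ℝ} (h : y ∈ Set.Ioo 0 π) :
    HasDerivAt qq ((sin y * cos y - y) / sin y ^ 2) y := by
  have hs : sin y ≠ 0 := (sin_pos_of_pos_of_lt_pi h.1 h.2).ne'
  have h1 : HasDerivAt (fun y => y * cos y / sin y) ((sin y * cos y - y) / sin y ^ 2) y := by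
    have h0 : HasDerivAt (fun y => y * cos y / sin y)
        (((1 * cos y + y * (-sin y)) * sin y - y * cos y * cos y) / sin y ^ 2) y :=
      ((hasDerivAt_id y).mul (hasDerivAt_cos y)).div (hasDerivAt_sin y) hs
    refine h0.congr_deriv ?_
    have := sin_sq_add_cos_sq y
    congr 1
    linear_combination (-y) * this
  refine h1.congr_of_eventuallyEq ?_
  filter_upwards [lt_mem_nhds h.1] with z hz
  exact qq_eq hz.ne'

lemma qq_deriv_hasDerivAt {y : ℝ} (h : y ∈ Set.Ioo 0 π) :
    HasDerivAt (fun y => (sin y * cos y - y) / sin y ^ 2)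
      (2 * (y * cos y - sin y) / sin y ^ 3) y := by
  have hs : sin y ≠ 0 := (sin_pos_of_pos_of_lt_pi h.1 h.2).ne'
  have h0 : HasDerivAt (fun y => (sin y * cos y - y) / sin y ^ 2)
      (((cos y * cos y + sin y * (-sin y) - 1) * sin y ^ 2
        - (sin y * cos y - y) * ((2 : ℕ) * sin y ^ (2 - 1) * cos y)) / (sin y ^ 2) ^ 2) y :=
    (((hasDerivAt_sin y).mul (hasDerivAt_cos y)).sub (hasDerivAt_id y)).div
      ((hasDerivAt_sin y).pow 2) (pow_ne_zero 2 hs)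
  refine h0.congr_deriv ?_
  have h2 := sin_sq_add_cos_sq y
  rw [div_eq_div_iff (pow_ne_zero _ (pow_ne_zero _ hs)) (pow_ne_zero _ hs)]
  push_cast
  simp only [show 2 - 1 = 1 from rfl, pow_one]
  linear_combination (- sin y ^ 5) * h2

lemma y_cos_le_sin {y : ℝ} (h : y ∈ Set.Icc 0 π) : y * cos y - sin y ≤ 0 := by
  have hanti : AntitoneOn (fun y => y * cos y - sin y) (Set.Icc 0 π) := by
    apply antitoneOn_of_deriv_nonpos (convex_Icc _ _) (by fun_prop) (by fun_prop)
    intro x hx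
    rw [interior_Icc] at hx
    have : HasDerivAt (fun y => y * cos y - sin y) (1 * cos x + x * (-sin x) - cos x) x :=
      ((hasDerivAt_id x).mul (hasDerivAt_cos x)).sub (hasDerivAt_sin x)
    rw [this.deriv]
    nlinarith [hx.1, sin_pos_of_pos_of_lt_pi hx.1 hx.2]
  simpa using hanti (Set.left_mem_Icc.2 pi_pos.le) h h.1

lemma qq_contOn : ContinuousOn qq (Set.Ico 0 π) := by
  unfold qq
  apply ContinuousOn.div continuous_cos.continuousOn continuous_sinc.continuousOn
  intro y hy
  exact (sinc_pos ⟨by linarith [hy.1, pi_pos], hy.2⟩).ne'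

lemma qq_concave_half : ConcaveOn ℝ (Set.Ico 0 π) qq := by
  apply concaveOn_of_hasDerivWithinAt2_nonpos (convex_Ico _ _) qq_contOn
    (f' := fun y => (sin y * cos y - y) / sin y ^ 2)
    (f'' := fun y => 2 * (y * cos y - sin y) / sin y ^ 3)
  · intro x hx
    rw [interior_Ico] at hx
    exact (qq_hasDerivAt hx).hasDerivWithinAt
  · intro x hx
    rw [interior_Ico] at hx
    exact (qq_deriv_hasDerivAt hx).hasDerivWithinAt
  · intro x hx
    rw [interior_Ico] at hx
    have := sin_pos_of_pos_of_lt_pi hx.1 hx.2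
    apply div_nonpos_of_nonpos_of_nonneg
    · linarith [y_cos_le_sin ⟨hx.1.le, hx.2.le⟩]
    · positivity

lemma qq_antitone_half : AntitoneOn qq (Set.Ico 0 π) := by
  apply antitoneOn_of_deriv_nonpos (convex_Ico _ _) qq_contOn
  · intro x hx
    rw [interior_Ico] at hx
    exact (qq_hasDerivAt hx).differentiableAt.differentiableWithinAt
  · intro x hx
    rw [interior_Ico] at hx
    rw [(qq_hasDerivAt hx).deriv]
    have hs := sin_pos_of_pos_of_lt_pi hx.1 hx.2
    apply div_nonpos_of_nonpos_of_nonneg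
    · have := sin_le hx.1.le
      have := cos_le_one x
      nlinarith
    · positivity

lemma qq_concave : ConcaveOn ℝ (Set.Ioo (-π) π) qq := by
  have e : qq = qq ∘ (fun y => |y|) := by ext y; simp [qq_abs]
  have im : (fun y : ℝ => |y|) '' (Set.Ioo (-π) π) ⊆ Set.Ico 0 π := by
    rintro _ ⟨y, hy, rfl⟩
    exact ⟨abs_nonneg y, abs_lt.2 hy⟩
  have im2 : (fun y : ℝ => |y|) '' (Set.Ioo (-π) π) = Set.Ico 0 π := by
    apply le_antisymm im
    intro y hy
    exact ⟨y, ⟨by linarith [hy.1, pi_pos], hy.2⟩, abs_of_nonneg hy.1⟩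
  rw [e]
  apply ConcaveOn.comp_convexOn
  · rw [im2]; exact qq_concave_half
  · exact (convexOn_norm (convex_Ioo (-π) π) : ConvexOn ℝ (Set.Ioo (-π) π) (fun y : ℝ => ‖y‖))
  · rw [im2]; exact qq_antitone_half

lemma qq_mid {x y z : ℝ} (hx : x ∈ Set.Ioo (-π) π) (hz : z ∈ Set.Ioo (-π) π)
    (h : 2 * y = x + z) : qq x + qq z ≤ 2 * qq y := by
  have := qq_concave.2 hx hz (show (0 : ℝ) ≤ 1 / 2 by norm_num) (show (0 : ℝ) ≤ 1 / 2 by norm_num)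
    (by norm_num)
  simp only [smul_eq_mul] at this
  rw [show 1 / 2 * x + 1 / 2 * z = y by linarith] at this
  linarith

lemma qq_step {x y : ℝ} (hx : x ∈ Set.Ioo (-π) π) (hy : y ∈ Set.Ioo 0 π) (h : x < y) :
    qq x - qq y ≤ (y - x) * (5 / sin y ^ 2) := by
  have := qq_concave.le_slope_of_hasDerivAt hx ⟨by linarith [hy.1, pi_pos], hy.2⟩ h
    (qq_hasDerivAt hy)
  have hs := sin_pos_of_pos_of_lt_pi hy.1 hy.2
  rw [slope_def_field, le_div_iff₀ (by linarith)] at this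
  have h2 : -(5 / sin y ^ 2) ≤ (sin y * cos y - y) / sin y ^ 2 := by
    rw [← neg_div]
    gcongr
    nlinarith [pi_lt_four, hy.2, neg_one_le_cos y, sin_le_one y]
  nlinarith [mul_le_mul_of_nonneg_right h2 (sub_nonneg.2 h.le)]

lemma FF_nonneg (n : ℕ) (hn : 1 ≤ n) {u : ℝ} (hu : u ∈ Set.Ioo 0 (2 * π)) : 0 ≤ FF n u := by
  unfold FF
  apply mul_nonneg (by positivity)
  apply Finset.sum_nonneg
  intro i hi
  have hi' := Finset.mem_range.1 hi
  have := qq_mid (nd_mem n (2 * i) hn (by omega) hu) (nd_mem n (2 * i + 2) hn (by omega) hu)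
    (y := (u - nd n (2 * i + 1)) / 2) (by unfold nd; push_cast; ring)
  linarith

lemma alt_sum_le (a : ℕ → ℝ) (N : ℕ)
    (ha : ∀ j, j + 2 ≤ N → a j + a (j + 2) ≤ 2 * a (j + 1)) (m : ℕ) (hm : 2 * (m + 1) ≤ N) :
    ∑ i ∈ Finset.range (m + 1), (2 * a (2 * i + 1) - a (2 * i) - a (2 * i + 2))
      ≤ (a 1 - a 0) + (a (2 * m + 1) - a (2 * m + 2)) := by
  induction m with
  | zero => simp; linarith
  | succ m ih =>
    rw [Finset.sum_range_succ]
    have h1 := ih (by omega)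
    have h2 := ha (2 * m + 1) (by omega)
    simp only [show 2 * (m + 1) = 2 * m + 2 by ring, show 2 * m + 1 + 2 = 2 * m + 3 by ring,
      show 2 * m + 1 + 1 = 2 * m + 2 by ring] at *
    linarith

lemma FF_le (n : ℕ) (hn : 1 ≤ n) {u : ℝ} (hu : u ∈ Set.Ioo 0 (2 * π)) :
    FF n u ≤ 5 * π / (4 * n ^ 2 * sin (u / 2) ^ 2) := by
  have hn0 : (0 : ℝ) < n := by exact_mod_cast hn
  have hs : 0 < sin (u / 2) := sin_pos_of_pos_of_lt_pi (by linarith [hu.1]) (by linarith [hu.2])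
  obtain ⟨m, hm⟩ : ∃ m, n = m + 1 := ⟨n - 1, by omega⟩
  have h1 := alt_sum_le (fun j => qq ((u - nd n j) / 2)) (2 * n) (by
    intro j hj
    exact qq_mid (nd_mem n j hn (by omega) hu) (nd_mem n (j + 2) hn (by omega) hu)
      (by unfold nd; push_cast; ring)) m (by omega)
  have h2 := qq_step (nd_mem n 1 hn (by omega) hu) (y := u / 2)
    ⟨by linarith [hu.1], by linarith [hu.2]⟩
    (by have : 0 < nd n 1 := by { unfold nd; positivity }
        linarith)
  have h3 := qq_step (x := -((u - nd n (2 * m + 1)) / 2)) (y := (2 * π - u) / 2)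
    (by have := nd_mem n (2 * m + 1) hn (by omega) hu
        exact ⟨by linarith [this.2], by linarith [this.1]⟩)
    ⟨by linarith [hu.2], by linarith [hu.1]⟩
    (by have : nd n (2 * m + 1) < 2 * π := by
          rw [← nd_two_n n hn]; unfold nd; gcongr; omega
        linarith)
  have e0 : nd n 0 = 0 := by simp [nd]
  have e2 : nd n (2 * m + 2) = 2 * π := by
    rw [← nd_two_n n hn, hm]; rfl
  have e3 : nd n (2 * m + 1) = 2 * π - π / n := by
    rw [← e2]; unfold nd; push_cast; field_simp; ring
  have e1 : nd n 1 = π / n := by simp [nd]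
  rw [qq_neg, ← qq_neg ((2 * π - u) / 2)] at h3
  have es : sin ((2 * π - u) / 2) = sin (u / 2) := by
    rw [show (2 * π - u) / 2 = π - u / 2 by ring, sin_pi_sub]
  rw [es, show -((2 * π - u) / 2) = (u - nd n (2 * m + 2)) / 2 by rw [e2]; ring] at h3
  rw [e1] at h2
  rw [e3] at h3
  simp only [e0, e1, e3, sub_zero] at h1
  unfold FF
  rw [show Finset.range n = Finset.range (m + 1) by rw [hm]]
  have h4 : (π / n) * (5 / sin (u / 2) ^ 2) = n * (4 * (5 * π / (4 * n ^ 2 * sin (u / 2) ^ 2))) := by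
    field_simp
  rw [one_div, inv_mul_le_iff₀ (by positivity)]
  refine h1.trans ?_
  nlinarith
end Nik

namespace Nik

/-- the sign of `sin (n u)` -/
noncomputable def sg (n : ℕ) (u : ℝ) : ℝ := |sin (n * u)| / sin (n * u)

lemma sg_mul_sin (n : ℕ) (u : ℝ) : sg n u * sin (n * u) = |sin (n * u)| := by
  unfold sg
  by_cases h : sin (n * u) = 0
  · simp [h]
  · field_simp

lemma sg_abs_le (n : ℕ) (u : ℝ) : |sg n u| ≤ 1 := by
  unfold sg
  rw [abs_div, abs_abs]
  exact div_self_le_one _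

lemma sg_neg (n : ℕ) (u : ℝ) : sg n (-u) = - sg n u := by
  unfold sg
  rw [mul_neg, sin_neg, abs_neg, div_neg]

lemma sg_sub_nd (n j : ℕ) (hn : 1 ≤ n) (u : ℝ) : sg n (u - nd n j) = (-1) ^ j * sg n u := by
  unfold sg
  rw [sin_nd n j hn, abs_mul, abs_pow, abs_neg, abs_one, one_pow, one_mul]
  rcases neg_one_pow_eq_or ℝ j with h | h <;> rw [h]
  · simp
  · rw [neg_one_mul, neg_one_mul, div_neg]

lemma sg_periodic (n : ℕ) (hn : 1 ≤ n) : Function.Periodic (sg n) (2 * π) := by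
  intro u
  have := sg_sub_nd n (2 * n) hn (u + 2 * π)
  rw [nd_two_n n hn] at this
  simpa using this.symm

lemma sg_measurable (n : ℕ) : Measurable (sg n) := by
  unfold sg; fun_prop

lemma sg_int (n : ℕ) {g : ℝ → ℝ} (hg : Continuous g) (a b : ℝ) :
    IntervalIntegrable (fun u => sg n u * g u) MeasureTheory.volume a b := by
  have h := hg.intervalIntegrable (μ := MeasureTheory.volume) a b
  rw [intervalIntegrable_iff] at h ⊢
  refine h.bdd_mul (c := 1) (sg_measurable n).aestronglyMeasurable ?_
  exact Filter.Eventually.of_forall fun u => sg_abs_le n u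

/-- continuous functions orthogonal to `sg` -/
def Orth (n : ℕ) (g : ℝ → ℝ) : Prop :=
  Continuous g ∧ ∫ u in (0 : ℝ)..(2 * π), sg n u * g u = 0

lemma Orth.add {n : ℕ} {g h : ℝ → ℝ} (hg : Orth n g) (hh : Orth n h) :
    Orth n (fun u => g u + h u) := by
  refine ⟨hg.1.add hh.1, ?_⟩
  simp_rw [mul_add]
  rw [intervalIntegral.integral_add (sg_int n hg.1 _ _) (sg_int n hh.1 _ _), hg.2, hh.2, add_zero]

lemma Orth.cmul {n : ℕ} {g : ℝ → ℝ} (c : ℝ) (hg : Orth n g) :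
    Orth n (fun u => c * g u) := by
  refine ⟨hg.1.const_mul c, ?_⟩
  simp_rw [mul_left_comm _ c]
  rw [intervalIntegral.integral_const_mul, hg.2, mul_zero]

lemma Orth.sum {n : ℕ} {g : ℕ → ℝ → ℝ} (hg : ∀ i, Orth n (g i)) (m : ℕ) :
    Orth n (fun u => ∑ i ∈ Finset.range m, g i u) := by
  induction m with
  | zero => exact ⟨by simpa using continuous_const, by simp⟩
  | succ m ih => simp_rw [Finset.sum_range_succ]; exact ih.add (hg m)

lemma orth_EK (n j : ℕ) (hn : 1 ≤ n) : Orth n (fun u => EK n (u - nd n j)) := by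
  refine ⟨(EK_cont n).comp (by fun_prop), ?_⟩
  have e (u : ℝ) : sg n u * EK n (u - nd n j)
      = (-1) ^ j * ((fun v => sg n v * EK n v) (u - nd n j)) := by
    simp only
    rw [sg_sub_nd n j hn, ← mul_assoc, ← mul_assoc, ← pow_add, ← two_mul]
    simp
  simp_rw [e]
  rw [intervalIntegral.integral_const_mul, intervalIntegral.integral_comp_sub_right
    (fun v => sg n v * EK n v)]
  have hp : Function.Periodic (fun v => sg n v * EK n v) (2 * π) :=
    (sg_periodic n hn).mul (EK_periodic n)
  have h1 := hp.intervalIntegral_add_eq (0 - nd n j) (-π)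
  rw [show 0 - nd n j + 2 * π = 2 * π - nd n j by ring, show -π + 2 * π = π by ring] at h1
  rw [h1]
  have h2 := intervalIntegral.integral_comp_neg (a := -π) (b := π) (fun v => sg n v * EK n v)
  simp only [sg_neg, EK_even, neg_neg, neg_mul, intervalIntegral.integral_neg] at h2
  have : ∫ v in -π..π, sg n v * EK n v = 0 := by linarith
  rw [this, mul_zero]

lemma orth_TT (n : ℕ) (hn : 1 ≤ n) : Orth n (TT n) := by
  unfold TT
  refine Orth.cmul _ (Orth.sum (fun i => ?_) n)
  exact (((orth_EK n _ hn).cmul _).add (((orth_EK n _ hn).cmul _).cmul _)).add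
    ((orth_EK n _ hn).cmul _)

lemma DD_cont (n : ℕ) (hn : 1 ≤ n) : Continuous (DD n) := by
  have := (orth_TT n hn).1
  unfold DD; fun_prop

lemma sg_on (n j : ℕ) (hn : 1 ≤ n) {u : ℝ} (hu : u ∈ Set.Ioo (nd n j) (nd n (j + 1))) :
    sg n u = (-1) ^ j := by
  have hn0 : (0 : ℝ) < n := by exact_mod_cast hn
  have h1 := sg_sub_nd n j hn u
  have h2 : sg n (u - nd n j) = 1 := by
    unfold sg
    have e : nd n (j + 1) = nd n j + π / n := by unfold nd; push_cast; ring
    have : 0 < sin (n * (u - nd n j)) := by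
      apply sin_pos_of_pos_of_lt_pi
      · exact mul_pos hn0 (by linarith [hu.1])
      · rw [mul_comm, ← lt_div_iff₀ hn0]; linarith [hu.2]
    rw [abs_of_pos this, div_self this.ne']
  rw [h2] at h1
  have h3 : ((-1 : ℝ) ^ j) * (-1) ^ j = 1 := by rw [← pow_add, ← two_mul]; simp
  calc sg n u = ((-1 : ℝ) ^ j * (-1) ^ j) * sg n u := by rw [h3, one_mul]
    _ = (-1) ^ j := by rw [mul_assoc, ← h1, mul_one]

lemma int_saw_piece (n j : ℕ) (hn : 1 ≤ n) :
    ∫ u in (nd n j)..(nd n (j + 1)), sg n u * ((π - u) / 2)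
      = (-1) ^ j * (π / n / 2 * (π - nd n j - π / n / 2)) := by
  have hn0 : (0 : ℝ) < n := by exact_mod_cast hn
  have e : nd n (j + 1) = nd n j + π / n := by unfold nd; push_cast; ring
  have hle : nd n j ≤ nd n (j + 1) := by rw [e]; have := pi_pos; linarith [div_pos pi_pos hn0]
  rw [intervalIntegral.integral_congr_Ioo_of_le (g := fun u => (-1) ^ j * ((π - u) / 2)) hle
    (fun u hu => by simp only [sg_on n j hn hu])]
  rw [intervalIntegral.integral_const_mul, intervalIntegral.integral_div,
    intervalIntegral.integral_sub (by simp) (by simp), integral_id,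
    intervalIntegral.integral_const, e]
  simp only [smul_eq_mul]
  ring

lemma int_saw (n : ℕ) (hn : 1 ≤ n) :
    ∫ u in (0 : ℝ)..(2 * π), sg n u * ((π - u) / 2) = π ^ 2 / (2 * n) := by
  have hn0 : (0 : ℝ) < n := by exact_mod_cast hn
  have h := intervalIntegral.sum_integral_adjacent_intervals (a := nd n) (n := 2 * n)
    (f := fun u => sg n u * ((π - u) / 2)) (μ := MeasureTheory.volume)
    (fun k _ => sg_int n (by fun_prop) _ _)
  rw [nd_two_n n hn, show nd n 0 = 0 by simp [nd]] at h
  rw [← h]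
  simp_rw [int_saw_piece n _ hn]
  have key (m : ℕ) : ∑ j ∈ Finset.range (2 * m),
      (-1 : ℝ) ^ j * (π / n / 2 * (π - nd n j - π / n / 2)) = m * (π / n) ^ 2 / 2 := by
    induction m with
    | zero => simp
    | succ m ih =>
      rw [show 2 * (m + 1) = 2 * m + 1 + 1 by ring, Finset.sum_range_succ, Finset.sum_range_succ,
        ih]
      have p0 : (-1 : ℝ) ^ (2 * m) = 1 := by simp
      have p1 : (-1 : ℝ) ^ (2 * m + 1) = -1 := by simp [pow_succ]
      rw [p0, p1]; unfold nd; push_cast; ring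
  rw [key]
  field_simp

lemma int_abs_DD (n : ℕ) (hn : 1 ≤ n) :
    ∫ u in (0 : ℝ)..(2 * π), |DD n u| = π ^ 2 / (2 * n) := by
  have e : Set.EqOn (fun u => |DD n u|)
      (fun u => sg n u * ((π - u) / 2) - sg n u * TT n u) (Set.Ioo 0 (2 * π)) := by
    intro u hu
    simp only
    rw [← mul_sub]
    change |DD n u| = sg n u * DD n u
    rw [DD_eq n hn hu, abs_mul, abs_of_nonneg (FF_nonneg n hn hu), ← mul_assoc, sg_mul_sin]
  rw [intervalIntegral.integral_congr_Ioo_of_le (by positivity) e,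
    intervalIntegral.integral_sub (sg_int n (by fun_prop) _ _) (sg_int n (orth_TT n hn).1 _ _),
    int_saw n hn, (orth_TT n hn).2, sub_zero]

lemma abs_sin_nat_mul (n : ℕ) (u : ℝ) : |sin (n * u)| ≤ n * |sin u| := by
  induction n with
  | zero => simp
  | succ n ih =>
    push_cast
    rw [add_mul, one_mul, sin_add]
    calc |sin (n * u) * cos u + cos (n * u) * sin u|
        ≤ |sin (n * u)| * |cos u| + |cos (n * u)| * |sin u| := by
          rw [← abs_mul, ← abs_mul]; exact abs_add_le _ _
      _ ≤ |sin (n * u)| * 1 + 1 * |sin u| := by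
          gcongr
          · exact abs_cos_le_one u
          · exact abs_cos_le_one _
      _ ≤ (n + 1) * |sin u| := by linarith

lemma sin_half_ge {u : ℝ} (hu : u ∈ Set.Icc 0 π) : u / 4 ≤ sin (u / 2) := by
  have h := mul_le_sin (x := u / 2) (by linarith [hu.1]) (by linarith [hu.2])
  refine le_trans ?_ h
  rw [div_mul_div_comm, div_le_div_iff₀ (by norm_num) (by positivity)]
  nlinarith [pi_lt_four, hu.1]

lemma point_bound (n : ℕ) (hn : 1 ≤ n) {u : ℝ} (hu : u ∈ Set.Ioo 0 (2 * π)) :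
    |sin u| * |DD n u| ≤ 30 * π / n ^ 2 * ((u + 1 / n)⁻¹ + (2 * π - u + 1 / n)⁻¹) := by
  have hn0 : (0 : ℝ) < n := by exact_mod_cast hn
  set σ := sin (u / 2) with hσ
  have hs : 0 < σ := sin_pos_of_pos_of_lt_pi (by linarith [hu.1]) (by linarith [hu.2])
  set m := |sin (n * u)| with hm
  have m0 : 0 ≤ m := abs_nonneg _
  have m1 : m ≤ 1 := abs_sin_le_one _
  have su : |sin u| ≤ 2 * σ := by
    rw [show u = 2 * (u / 2) by ring, sin_two_mul, abs_mul, abs_mul, abs_two, abs_of_pos hs]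
    have := abs_cos_le_one (u / 2)
    nlinarith
  have m2 : m ≤ n * (2 * σ) := (abs_sin_nat_mul n u).trans (by gcongr)
  have hF := FF_le n hn hu
  have hF0 := FF_nonneg n hn hu
  rw [DD_eq n hn hu, abs_mul, abs_of_nonneg hF0, ← hm]
  have h1 : |sin u| * (m * FF n u) ≤ (2 * σ) * (m * (5 * π / (4 * n ^ 2 * σ ^ 2))) := by
    gcongr
  have h2 : (2 * σ) * (m * (5 * π / (4 * n ^ 2 * σ ^ 2))) = (5 * π / (2 * n ^ 2)) * (m / σ) := by
    field_simp; ring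
  have h3 : m / σ ≤ 3 / (σ + 1 / n) := by
    rw [div_le_div_iff₀ hs (by positivity)]
    have : m * (1 / n) ≤ 2 * σ := by
      rw [mul_one_div, div_le_iff₀ hn0]; linarith
    nlinarith
  have p1 : 0 < (u + 1 / n)⁻¹ := by have := hu.1; positivity
  have p2 : 0 < (2 * π - u + 1 / n)⁻¹ := by
    have : 0 < 2 * π - u := by linarith [hu.2]
    positivity
  have hn1 : 0 < 1 / (n : ℝ) := by positivity
  have h4 : 3 / (σ + 1 / n) ≤ 12 * ((u + 1 / n)⁻¹ + (2 * π - u + 1 / n)⁻¹) := by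
    rcases le_total u π with hc | hc
    · have h5 := sin_half_ge ⟨hu.1.le, hc⟩
      have : 3 / (σ + 1 / n) ≤ 12 * (u + 1 / n)⁻¹ := by
        rw [← div_eq_mul_inv, div_le_div_iff₀ (by positivity) (inv_pos.1 p1)]
        linarith
      linarith
    · have h5 := sin_half_ge (u := 2 * π - u) ⟨by linarith [hu.2], by linarith⟩
      rw [show (2 * π - u) / 2 = π - u / 2 by ring, sin_pi_sub] at h5
      have : 3 / (σ + 1 / n) ≤ 12 * (2 * π - u + 1 / n)⁻¹ := by
        rw [← div_eq_mul_inv, div_le_div_iff₀ (by positivity) (inv_pos.1 p2)]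
        linarith
      linarith
  calc _ ≤ _ := h1
    _ = _ := h2
    _ ≤ (5 * π / (2 * n ^ 2)) * (12 * ((u + 1 / n)⁻¹ + (2 * π - u + 1 / n)⁻¹)) := by
      gcongr
      exact h3.trans h4
    _ = _ := by ring

lemma int_sin_DD (n : ℕ) (hn : 1 ≤ n) :
    ∫ u in (0 : ℝ)..(2 * π), |sin u| * |DD n u| ≤ 180 * π * log (n + 1) / n ^ 2 := by
  have hn0 : (0 : ℝ) < n := by exact_mod_cast hn
  have hn1 : (1 : ℝ) ≤ n := by exact_mod_cast hn
  have hpi := pi_pos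
  have hi : 0 < 1 / (n : ℝ) := by positivity
  have c1 : ContinuousOn (fun u : ℝ => (u + 1 / (n : ℝ))⁻¹) (Set.uIcc 0 (2 * π)) := by
    apply ContinuousOn.inv₀ (by fun_prop)
    intro u hu
    rw [Set.uIcc_of_le (by positivity)] at hu
    have := hu.1
    positivity
  have c2 : ContinuousOn (fun u : ℝ => (2 * π - u + 1 / (n : ℝ))⁻¹) (Set.uIcc 0 (2 * π)) := by
    apply ContinuousOn.inv₀ (by fun_prop)
    intro u hu
    rw [Set.uIcc_of_le (by positivity)] at hu
    have : 0 ≤ 2 * π - u := by linarith [hu.2]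
    positivity
  have hD := DD_cont n hn
  have h1 := intervalIntegral.integral_mono_on_of_le_Ioo (a := 0) (b := 2 * π)
    (μ := MeasureTheory.volume) (by positivity)
    (Continuous.intervalIntegrable (u := fun u => |sin u| * |DD n u|) (by fun_prop) _ _)
    (((c1.add c2).const_mul (30 * π / n ^ 2)).intervalIntegrable)
    (fun u hu => point_bound n hn hu)
  refine h1.trans ?_
  simp only [Pi.add_apply]
  rw [intervalIntegral.integral_const_mul,
    intervalIntegral.integral_add c1.intervalIntegrable c2.intervalIntegrable]
  have i1 : ∫ u in (0 : ℝ)..(2 * π), (u + 1 / (n : ℝ))⁻¹ = log (2 * π * n + 1) := by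
    rw [intervalIntegral.integral_comp_add_right (fun u => u⁻¹),
      integral_inv_of_pos (by positivity) (by positivity)]
    congr 1; field_simp; ring
  have i2 : ∫ u in (0 : ℝ)..(2 * π), (2 * π - u + 1 / (n : ℝ))⁻¹ = log (2 * π * n + 1) := by
    rw [intervalIntegral.integral_comp_sub_left (fun u => (u + 1 / (n : ℝ))⁻¹)]
    simpa using i1
  rw [i1, i2]
  have hl : log (2 * π * n + 1) ≤ 3 * log (n + 1) := by
    have : (3 : ℝ) * log (n + 1) = log ((n + 1) ^ 3) := by rw [log_pow]; norm_num
    rw [this]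
    apply log_le_log (by positivity)
    have h7 : 2 * π * n ≤ 7 * n := by gcongr; linarith [pi_lt_d2]
    have h8 : (n : ℝ) ≤ n ^ 2 := by nlinarith
    have h9 : (n : ℝ) ≤ n ^ 3 := by nlinarith
    nlinarith
  calc 30 * π / n ^ 2 * (log (2 * π * n + 1) + log (2 * π * n + 1))
      ≤ 30 * π / n ^ 2 * (3 * log (n + 1) + 3 * log (n + 1)) := by gcongr
    _ = _ := by ring

end Nik

namespace Nik

/-- trigonometric polynomials of degree at most `n` -/
def IsTrig (n : ℕ) (T : ℝ → ℝ) : Prop :=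
  ∃ a b : ℕ → ℝ, ∀ u, T u = ∑ k ∈ Finset.range (n + 1), (a k * cos (k * u) + b k * sin (k * u))

lemma IsTrig.add {n : ℕ} {g h : ℝ → ℝ} (hg : IsTrig n g) (hh : IsTrig n h) :
    IsTrig n (fun u => g u + h u) := by
  obtain ⟨a, b, H⟩ := hg
  obtain ⟨a', b', H'⟩ := hh
  refine ⟨fun k => a k + a' k, fun k => b k + b' k, fun u => ?_⟩
  simp only [H, H']
  rw [← Finset.sum_add_distrib]
  exact Finset.sum_congr rfl fun k _ => by ring

lemma IsTrig.cmul {n : ℕ} {g : ℝ → ℝ} (c : ℝ) (hg : IsTrig n g) :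
    IsTrig n (fun u => c * g u) := by
  obtain ⟨a, b, H⟩ := hg
  refine ⟨fun k => c * a k, fun k => c * b k, fun u => ?_⟩
  simp only [H]
  rw [Finset.mul_sum]
  exact Finset.sum_congr rfl fun k _ => by ring

lemma IsTrig.zero (n : ℕ) : IsTrig n (fun _ => 0) :=
  ⟨fun _ => 0, fun _ => 0, fun u => by simp⟩

lemma IsTrig.sum {n : ℕ} {g : ℕ → ℝ → ℝ} (m : ℕ) (hg : ∀ i < m, IsTrig n (g i)) :
    IsTrig n (fun u => ∑ i ∈ Finset.range m, g i u) := by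
  induction m with
  | zero => simpa using IsTrig.zero n
  | succ m ih =>
    simp_rw [Finset.sum_range_succ]
    exact (ih fun i hi => hg i (by omega)).add (hg m (by omega))

lemma isTrig_cos {n k : ℕ} (hk : k ≤ n) (v : ℝ) : IsTrig n (fun u => cos (k * (u - v))) := by
  refine ⟨fun j => if j = k then cos (k * v) else 0, fun j => if j = k then sin (k * v) else 0,
    fun u => ?_⟩
  rw [Finset.sum_eq_single k]
  · simp only [if_true]
    rw [mul_sub, cos_sub]; ring
  · intro j _ hj; simp [hj]
  · intro h; exact absurd (Finset.mem_range.2 (by omega)) h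

lemma isTrig_EK (n : ℕ) (v : ℝ) : IsTrig n (fun u => EK n (u - v)) := by
  unfold EK
  exact IsTrig.sum n fun k hk => (isTrig_cos hk.le v).add (isTrig_cos hk v)

lemma isTrig_TT (n : ℕ) : IsTrig n (TT n) := by
  unfold TT
  refine IsTrig.cmul _ (IsTrig.sum n fun i _ => ?_)
  exact (((isTrig_EK n _).cmul _).add (((isTrig_EK n _).cmul _).cmul _)).add
    ((isTrig_EK n _).cmul _)

lemma isTrig_deriv {n : ℕ} {T : ℝ → ℝ} (h : IsTrig n T) :
    ∃ K : ℝ → ℝ, IsTrig n K ∧ ∀ u, HasDerivAt T (K u - 1 / 2) u := by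
  obtain ⟨a, b, H⟩ := h
  refine ⟨fun u => (∑ k ∈ Finset.range (n + 1),
    ((k * b k) * cos (k * u) + (-(k * a k)) * sin (k * u))) + 1 / 2, ?_, fun u => ?_⟩
  · refine IsTrig.add ⟨_, _, fun u => rfl⟩ ?_
    have := (isTrig_cos (n := n) (Nat.zero_le n) 0).cmul (1 / 2)
    simpa using this
  · have e : T = fun u => ∑ k ∈ Finset.range (n + 1), (a k * cos (k * u) + b k * sin (k * u)) :=
      funext H
    rw [e, add_sub_cancel_right]
    refine HasDerivAt.fun_sum fun k _ => ?_
    have hk : HasDerivAt (fun u : ℝ => (k : ℝ) * u) k u := by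
      simpa using (hasDerivAt_id u).const_mul (k : ℝ)
    have h1 := (hk.cos.const_mul (a k)).add (hk.sin.const_mul (b k))
    exact h1.congr_deriv (by ring)

lemma IsTrig.cont {n : ℕ} {T : ℝ → ℝ} (h : IsTrig n T) : Continuous T := by
  obtain ⟨a, b, H⟩ := h
  rw [funext H]; fun_prop

lemma IsTrig.periodic {n : ℕ} {T : ℝ → ℝ} (h : IsTrig n T) : Function.Periodic T (2 * π) := by
  obtain ⟨a, b, H⟩ := h
  intro u
  rw [H, H]
  refine Finset.sum_congr rfl fun k _ => ?_
  rw [mul_add, cos_add_nat_mul_two_pi, sin_add_nat_mul_two_pi]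

lemma exists_poly {n : ℕ} {K g : ℝ → ℝ} (hK : IsTrig n K) (hg : Continuous g)
    (hgp : Function.Periodic g (2 * π)) :
    ∃ p : Polynomial ℝ, p.natDegree ≤ n ∧ ∀ t,
      (∫ u in (0 : ℝ)..(2 * π), g (t + u) * K u) + (∫ u in (0 : ℝ)..(2 * π), g (-t + u) * K u)
        = 2 * p.eval (cos t) := by
  have hKc := hK.cont
  have hKp := hK.periodic
  obtain ⟨a, b, H⟩ := hK
  have shift (t : ℝ) : ∫ u in (0 : ℝ)..(2 * π), g (t + u) * K u
      = ∫ s in (0 : ℝ)..(2 * π), g s * K (s - t) := by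
    have h1 := intervalIntegral.integral_comp_add_left (a := 0) (b := 2 * π)
      (fun s => g s * K (s - t)) t
    simp only [add_sub_cancel_left] at h1
    rw [h1]
    have hp : Function.Periodic (fun s => g s * K (s - t)) (2 * π) := by
      intro s
      simp only
      rw [hgp s, show s + 2 * π - t = s - t + 2 * π by ring, hKp]
    have h2 := hp.intervalIntegral_add_eq (t + 0) 0
    rwa [add_zero, zero_add] at *
  refine ⟨∑ k ∈ Finset.range (n + 1),
    Polynomial.C (∫ s in (0 : ℝ)..(2 * π), g s * (a k * cos (k * s) + b k * sin (k * s)))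
      * Polynomial.Chebyshev.T ℝ k, ?_, fun t => ?_⟩
  · apply Polynomial.natDegree_sum_le_of_forall_le
    intro k hk
    refine (Polynomial.natDegree_C_mul_le _ _).trans ?_
    rw [Polynomial.Chebyshev.natDegree_T]
    have := Finset.mem_range.1 hk
    simp; omega
  · rw [shift, shift, ← intervalIntegral.integral_add
      (Continuous.intervalIntegrable (by fun_prop) _ _)
      (Continuous.intervalIntegrable (by fun_prop) _ _)]
    have e (s : ℝ) : g s * K (s - t) + g s * K (s - -t) = ∑ k ∈ Finset.range (n + 1),
        (2 * cos (k * t)) * (g s * (a k * cos (k * s) + b k * sin (k * s))) := by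
      rw [H, H, ← mul_add, ← Finset.sum_add_distrib, Finset.mul_sum]
      refine Finset.sum_congr rfl fun k _ => ?_
      rw [sub_neg_eq_add, mul_sub, mul_add (k : ℝ), cos_sub, cos_add, sin_sub, sin_add]
      ring
    simp_rw [e]
    rw [intervalIntegral.integral_finsetSum
      (fun k _ => Continuous.intervalIntegrable (by fun_prop) _ _), Polynomial.eval_finsetSum,
      Finset.mul_sum]
    refine Finset.sum_congr rfl fun k _ => ?_
    rw [intervalIntegral.integral_const_mul, Polynomial.eval_mul, Polynomial.eval_C,
      Polynomial.Chebyshev.T_real_cos]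
    push_cast
    ring

lemma deriv_bound {g : ℝ → ℝ} (hg : ∀ s r, |g s - g r| ≤ |cos s - cos r|) (s : ℝ) :
    |deriv g s| ≤ |sin s| := by
  by_cases hd : DifferentiableAt ℝ g s
  · have h1 := (hasDerivAt_iff_tendsto_slope.1 hd.hasDerivAt).abs
    have h2 := (hasDerivAt_iff_tendsto_slope.1 (hasDerivAt_cos s)).abs
    rw [abs_neg] at h2
    refine le_of_tendsto_of_tendsto h1 h2 (Filter.Eventually.of_forall fun r => ?_)
    simp only [slope_def_field, abs_div]
    exact div_le_div_of_nonneg_right (hg r s) (abs_nonneg _)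
  · rw [deriv_zero_of_not_differentiableAt hd]; simp

lemma err_bound (n : ℕ) (hn : 1 ≤ n) {g K : ℝ → ℝ}
    (hg : ∀ s r, |g s - g r| ≤ |cos s - cos r|)
    (hKc : Continuous K) (hT : ∀ u, HasDerivAt (TT n) (K u - 1 / 2) u) (t : ℝ) :
    |π * g t - ∫ u in (0 : ℝ)..(2 * π), g (t + u) * K u|
      ≤ |sin t| * (π ^ 2 / (2 * n)) + 180 * π * log (n + 1) / n ^ 2 := by
  have hpi := pi_pos
  have hLip : LipschitzWith 1 g := by
    apply LipschitzWith.of_dist_le_mul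
    intro s r
    rw [NNReal.coe_one, one_mul, Real.dist_eq, Real.dist_eq]
    refine (hg s r).trans ?_
    simpa using abs_cos_sub_cos_le s r
  have hgc := hLip.continuous
  have hLip' : LipschitzWith 1 (fun u => g (t + u)) := by
    apply LipschitzWith.of_dist_le_mul
    intro s r
    simpa using hLip.dist_le_mul (t + s) (t + r)
  have hD (u : ℝ) : HasDerivAt (DD n) (-K u) u := by
    have h0 : HasDerivAt (fun u => (π - u) / 2) (-1 / 2) u :=
      ((hasDerivAt_id u).const_sub π).div_const 2
    exact (h0.sub (hT u)).congr_deriv (by ring)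
  have hDd : deriv (DD n) = fun u => -K u := funext fun u => (hD u).deriv
  have hDc := DD_cont n hn
  have acg : AbsolutelyContinuousOnInterval (fun u => g (t + u)) 0 (2 * π) :=
    (hLip'.lipschitzOnWith).absolutelyContinuousOnInterval
  have acD : AbsolutelyContinuousOnInterval (DD n) 0 (2 * π) := by
    have : ContDiff ℝ 1 (DD n) := by
      rw [contDiff_one_iff_deriv, hDd]
      exact ⟨fun u => (hD u).differentiableAt, by fun_prop⟩
    exact this.contDiffOn.absolutelyContinuousOnInterval
  have ibp := acg.integral_mul_deriv_eq_deriv_mul acD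
  have hper : TT n (2 * π) = TT n 0 := by
    simpa using (isTrig_TT n).periodic 0
  have gper : g (t + 2 * π) = g t := by
    have := hg (t + 2 * π) t
    rw [cos_add_two_pi, sub_self, abs_zero] at this
    exact sub_eq_zero.1 (abs_nonpos_iff.1 this)
  have e : π * g t - ∫ u in (0 : ℝ)..(2 * π), g (t + u) * K u
      = - ∫ u in (0 : ℝ)..(2 * π), deriv (fun u => g (t + u)) u * DD n u := by
    rw [hDd] at ibp
    simp only [mul_neg, intervalIntegral.integral_neg, gper, add_zero] at ibp
    have d1 : DD n (2 * π) = -π / 2 - TT n 0 := by unfold DD; rw [hper]; ring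
    have d0 : DD n 0 = π / 2 - TT n 0 := by unfold DD; ring
    rw [d1, d0] at ibp
    linarith
  rw [e, abs_neg]
  have hder (u : ℝ) : |deriv (fun u => g (t + u)) u| ≤ |sin (t + u)| := by
    rw [deriv_comp_const_add]
    exact deriv_bound hg _
  have hb (u : ℝ) : ‖deriv (fun u => g (t + u)) u * DD n u‖
      ≤ |sin t| * |DD n u| + |sin u| * |DD n u| := by
    rw [Real.norm_eq_abs, abs_mul, ← add_mul]
    gcongr
    refine (hder u).trans ?_
    rw [sin_add]
    calc |sin t * cos u + cos t * sin u| ≤ |sin t| * |cos u| + |cos t| * |sin u| := by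
          rw [← abs_mul, ← abs_mul]; exact abs_add_le _ _
      _ ≤ |sin t| * 1 + 1 * |sin u| := by
          gcongr
          · exact abs_cos_le_one _
          · exact abs_cos_le_one _
      _ = _ := by ring
  have h1 := intervalIntegral.norm_integral_le_of_norm_le (a := 0) (b := 2 * π)
    (μ := MeasureTheory.volume) (by positivity)
    (Filter.Eventually.of_forall fun u _ => hb u)
    (Continuous.intervalIntegrable (by fun_prop) _ _)
  rw [intervalIntegral.integral_add (Continuous.intervalIntegrable (by fun_prop) _ _)
    (Continuous.intervalIntegrable (by fun_prop) _ _), intervalIntegral.integral_const_mul,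
    int_abs_DD n hn, Real.norm_eq_abs] at h1
  linarith [int_sin_DD n hn]

end Nik

theorem nikolskii_pointwise_approx_W1 :
    ∃ C : ℝ, ∀ f : ℝ → ℝ,
      (∀ x ∈ Set.Icc (-1 : ℝ) 1, ∀ y ∈ Set.Icc (-1 : ℝ) 1, |f x - f y| ≤ |x - y|) →
      ∀ n : ℕ, 1 ≤ n →
        ∃ p : Polynomial ℝ, p.natDegree ≤ n ∧
          ∀ x ∈ Set.Icc (-1 : ℝ) 1,
            |f x - p.eval x| ≤
              (Real.pi / 2) * Real.sqrt (1 - x ^ 2) / n + C * Real.log (n + 1) / n ^ 2 := by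
  refine ⟨180, fun f hf n hn => ?_⟩
  have hpi := pi_pos
  have hn0 : (0 : ℝ) < n := by exact_mod_cast hn
  have hg : ∀ s r, |(fun t => f (cos t)) s - (fun t => f (cos t)) r| ≤ |cos s - cos r| :=
    fun s r => hf _ (cos_mem_Icc s) _ (cos_mem_Icc r)
  have hgc : Continuous (fun t => f (cos t)) := by
    have hfc : ContinuousOn f (Set.Icc (-1) 1) := by
      have : LipschitzOnWith 1 f (Set.Icc (-1) 1) := by
        apply LipschitzOnWith.of_dist_le_mul
        intro x hx y hy
        rw [NNReal.coe_one, one_mul, Real.dist_eq, Real.dist_eq]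
        exact hf x hx y hy
      exact this.continuousOn
    exact hfc.comp_continuous continuous_cos cos_mem_Icc
  have hgp : Function.Periodic (fun t => f (cos t)) (2 * π) := by
    intro t; simp only [cos_add_two_pi]
  obtain ⟨K, hK, hT⟩ := Nik.isTrig_deriv (Nik.isTrig_TT n)
  obtain ⟨p, hp, hpe⟩ := Nik.exists_poly hK hgc hgp
  refine ⟨Polynomial.C (1 / π) * p, (Polynomial.natDegree_C_mul_le _ _).trans hp, fun x hx => ?_⟩
  set t := arccos x with ht
  have hxt : cos t = x := cos_arccos hx.1 hx.2
  have hst : sin t = √(1 - x ^ 2) := sin_arccos x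
  have h1 := Nik.err_bound n hn hg hK.cont hT t
  have h2 := Nik.err_bound n hn hg hK.cont hT (-t)
  have h3 := hpe t
  simp only [cos_neg, sin_neg, abs_neg, hxt] at h1 h2 h3
  rw [hst, abs_of_nonneg (sqrt_nonneg _)] at h1 h2
  have h4 : |f x - (1 / π) * p.eval x| * π ≤
      √(1 - x ^ 2) * (π ^ 2 / (2 * n)) + 180 * π * log (n + 1) / n ^ 2 := by
    rw [← abs_of_pos hpi, ← abs_mul, abs_of_pos hpi]
    have e : (f x - (1 / π) * p.eval x) * π = π * f x - p.eval x := by field_simp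
    rw [e]
    rw [abs_le] at h1 h2 ⊢
    constructor
    · linarith [h1.1, h2.1]
    · linarith [h1.2, h2.2]
  rw [Polynomial.eval_mul, Polynomial.eval_C]
  refine le_of_mul_le_mul_right (h4.trans_eq ?_) hpi
  field_simp
end

section
/- (Brudny, 1974) For every r ∈ ℕ there exists a constant c(r) such that for every continuous function f : [−1,1] → ℝ and every integer n ≥ r there exists a real algebraic polynomial p_n of degree at most n such that for all x ∈ [−1,1]: |f(x) − p_n(x)| ≤ c(r)·ω_r(f; δ_n(x)), where δ_n(x) = √(1−x²)/n + 1/n². -/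
open Real

/-- The `r`-th modulus of smoothness of `f` on the interval `[−1,1]`:
`ω_r(f,h) = sup{|Σ_{k=0}^r (−1)^{r−k} C(r,k) f(x+kt)| : 0 ≤ t ≤ h, x ∈ [−1,1], x+rt ∈ [−1,1]}`. -/
noncomputable def modulusSmoothnessOn (r : ℕ) (f : ℝ → ℝ) (h : ℝ) : ℝ :=
  sSup {v : ℝ | ∃ t x : ℝ, 0 ≤ t ∧ t ≤ h ∧
    x ∈ Set.Icc (-1 : ℝ) 1 ∧ x + r * t ∈ Set.Icc (-1 : ℝ) 1 ∧
    v = |∑ k ∈ Finset.range (r + 1), (-1 : ℝ) ^ (r - k) * (r.choose k : ℝ) * f (x + k * t)|}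

/-- `r`-th forward difference. -/
noncomputable def fD (r : ℕ) (G : ℝ → ℝ) (z t : ℝ) : ℝ :=
  ∑ k ∈ Finset.range (r + 1), (-1 : ℝ) ^ (r - k) * (r.choose k : ℝ) * G (z + k * t)

lemma seq_growth (r : ℕ) (ω : ℝ) (hω : 0 ≤ ω) : ∀ (a : ℕ → ℝ) (N : ℕ), (∀ j < r, a j = 0) →
    (∀ j, j + r ≤ N → |(fwdDiff 1)^[r] a j| ≤ ω) → ∀ j ≤ N, |a j| ≤ (j : ℝ) ^ r * ω := by
  induction r with
  | zero =>
    intro a N _ h j hj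
    simpa using h j (by omega)
  | succ r ih =>
    intro a N h0 h j hj
    have hb : ∀ i, i + 1 ≤ N → |fwdDiff 1 a i| ≤ (i : ℝ) ^ r * ω := by
      intro i hi
      refine ih (fwdDiff 1 a) (N - 1) ?_ ?_ i (by omega)
      · intro j hj
        simp [fwdDiff, h0 j (by omega), h0 (j + 1) (by omega)]
      · intro j hj
        have := h j (by omega)
        rwa [Function.iterate_succ_apply] at this
    induction j with
    | zero => simp [h0 0 (by omega)]
    | succ j ihj =>
      have h1 := ihj (by omega)
      have h2 := hb j hj
      have h3 : a (j + 1) = a j + fwdDiff 1 a j := by simp [fwdDiff]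
      have hp : (j : ℝ) ^ r ≤ ((j : ℝ) + 1) ^ r := pow_le_pow_left₀ (by positivity) (by linarith) r
      rw [h3]
      calc |a j + fwdDiff 1 a j| ≤ |a j| + |fwdDiff 1 a j| := abs_add_le _ _
        _ ≤ (j : ℝ) ^ (r + 1) * ω + (j : ℝ) ^ r * ω := add_le_add h1 h2
        _ = (j : ℝ) ^ r * ((j + 1) * ω) := by ring
        _ ≤ ((j : ℝ) + 1) ^ r * ((j + 1) * ω) := by gcongr
        _ = _ := by push_cast; ring

structure GHyp (r : ℕ) (H ω α β : ℝ) (G : ℝ → ℝ) : Prop where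
  cont : Continuous G
  zero : ∀ i : ℕ, i < r → G i = 0
  ha : α ≤ 0
  hb : (r : ℝ) - 1 ≤ β
  diff : ∀ z t, 0 ≤ t → t ≤ H → α ≤ z → z + r * t ≤ β → |fD r G z t| ≤ ω

lemma GHyp.refl {r : ℕ} {H ω α β : ℝ} {G : ℝ → ℝ} (h : GHyp r H ω α β G) :
    GHyp r H ω (r - 1 - β) (r - 1 - α) (fun z => G (r - 1 - z)) where
  cont := h.cont.comp (by fun_prop)
  zero := by
    intro i hi
    have := h.zero (r - 1 - i) (by omega)
    rw [← this]
    congr 1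
    rw [Nat.cast_sub (by omega), Nat.cast_sub (by omega)]; simp
  ha := by linarith [h.hb]
  hb := by linarith [h.ha]
  diff := by
    intro z t ht htH hz hzt
    have h1 := h.diff (r - 1 - z - r * t) t ht htH (by linarith) (by linarith)
    have h2 : fD r (fun z => G (r - 1 - z)) z t = (-1) ^ r * fD r G (r - 1 - z - r * t) t := by
      unfold fD
      rw [← Finset.sum_range_reflect, Finset.mul_sum]
      refine Finset.sum_congr rfl ?_
      intro k hk
      have hk' : k ≤ r := by simpa [Nat.lt_succ_iff] using hk
      have e1 : r + 1 - 1 - k = r - k := by omega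
      rw [e1, Nat.choose_symm hk']
      have e2 : r - (r - k) = k := by omega
      rw [e2, Nat.cast_sub hk']
      have e3 : (-1 : ℝ) ^ r * (-1) ^ (r - k) = (-1) ^ k := by
        have : r = (r - k) + k := by omega
        conv_lhs => rw [this]
        rw [pow_add]
        have e4 : (r - k + k - k) = r - k := by omega
        rw [e4]
        have : ((-1 : ℝ) ^ (r - k)) * (-1) ^ (r - k) = 1 := by rw [← mul_pow]; simp
        linear_combination (-1 : ℝ) ^ k * this
      rw [← e3]
      have e5 : (r : ℝ) - 1 - (z + (r - k) * t) = r - 1 - z - r * t + k * t := by ring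
      beta_reduce
      rw [e5]; ring
    rw [h2, abs_mul]
    simpa using h1

lemma fD_nat (r : ℕ) (G : ℝ → ℝ) (j : ℕ) :
    (fwdDiff 1)^[r] (fun i : ℕ => G i) j = fD r G j 1 := by
  rw [fwdDiff_iter_eq_sum_shift]
  unfold fD
  refine Finset.sum_congr rfl ?_
  intro k _
  simp

lemma GHyp.nat_bound {r : ℕ} {H ω α β : ℝ} {G : ℝ → ℝ} (h : GHyp r H ω α β G) (hω : 0 ≤ ω)
    (hH : 1 ≤ H) (j : ℕ) (hj : (j : ℝ) ≤ β) : |G j| ≤ (j : ℝ) ^ r * ω := by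
  refine seq_growth r ω hω (fun i : ℕ => G i) j h.zero ?_ j le_rfl
  intro i hi
  rw [fD_nat]
  refine h.diff _ _ (by norm_num) hH (h.ha.trans (by positivity)) ?_
  have : ((i : ℝ) + r) ≤ j := by exact_mod_cast hi
  linarith

/-- weight -/
noncomputable def wt (r : ℕ) (H z : ℝ) : ℝ := (H + |z| + |z - (r - 1)|) ^ r

lemma GHyp.int_bound {r : ℕ} {H ω α β : ℝ} {G : ℝ → ℝ} (h : GHyp r H ω α β G) (hω : 0 ≤ ω)
    (hH : 1 ≤ H) (hr : 1 ≤ r) (j : ℤ) (hj : (j : ℝ) ≤ β) (hj' : α ≤ j) : |G j| ≤ wt r H j * ω := by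
  have hr' : (1 : ℝ) ≤ r := by exact_mod_cast hr
  rcases le_or_gt 0 j with hj0 | hj0
  · lift j to ℕ using hj0
    have := h.nat_bound hω hH j (by simpa using hj)
    refine le_trans (by simpa using this) ?_
    unfold wt
    gcongr
    have := abs_nonneg ((j : ℝ) - (r - 1))
    have := le_abs_self (j : ℝ)
    push_cast
    linarith
  · obtain ⟨m, hm⟩ : ∃ m : ℕ, (m : ℤ) = r - 1 - j := ⟨(r - 1 - j).toNat, by omega⟩
    have hm' : (m : ℝ) = r - 1 - j := by exact_mod_cast hm
    have := h.refl.nat_bound hω hH m (by rw [hm']; linarith)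
    have e : (r : ℝ) - 1 - m = j := by rw [hm']; ring
    simp only [e] at this
    refine this.trans ?_
    unfold wt
    gcongr
    have := neg_abs_le ((j : ℝ) - (r - 1))
    have := abs_nonneg (j : ℝ)
    linarith

lemma GHyp.avg {r : ℕ} {H ω α β K : ℝ} {G : ℝ → ℝ} (h : GHyp r H ω α β G)
    (hH : 1 ≤ H) {z z' : ℝ} (hz : α ≤ z) (hzz : z ≤ z') (hz1 : z' ≤ z + 1)
    (hz' : z' + r * H ≤ β) (hK0 : 0 ≤ K) (hK : ∀ y, z ≤ y → y ≤ z' + r * H → |G y| ≤ K) :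
    |G z - G z'| ≤ 2 * ω + 2 ^ r * (2 * K) / H := by
  have hc := h.cont
  have hH0 : 0 < H := by linarith
  set I : ℕ → ℝ → ℝ := fun k z => ∫ t in (0:ℝ)..H, G (z + k * t) with hI
  have hint : ∀ z, α ≤ z → z + r * H ≤ β → |∫ t in (0:ℝ)..H, fD r G z t| ≤ ω * H := by
    intro z hz hzr
    have := intervalIntegral.norm_integral_le_of_norm_le_const (a := 0) (b := H) (C := ω)
      (f := fun t => fD r G z t) (by
        intro t ht
        rw [Set.uIoc_of_le hH0.le] at ht
        refine h.diff z t ht.1.le ht.2 hz ?_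
        have : (r : ℝ) * t ≤ r * H := by gcongr; exact ht.2
        linarith)
    simpa [abs_of_pos hH0] using this
  have hsum : ∀ z, (∫ t in (0:ℝ)..H, fD r G z t) =
      (∑ k ∈ Finset.range r, (-1 : ℝ) ^ (r - (k+1)) * (r.choose (k+1) : ℝ) * I (k+1) z)
        + (-1) ^ r * (H * G z) := by
    intro z
    unfold fD
    rw [intervalIntegral.integral_finsetSum]
    · rw [Finset.sum_range_succ']
      simp [hI]
    · intro k _
      apply Continuous.intervalIntegrable
      fun_prop
  have hId : ∀ k : ℕ, k < r → |I (k+1) z - I (k+1) z'| ≤ 2 * K := by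
    intro k hk
    have e : ∀ z, ((k+1 : ℕ) : ℝ) * I (k+1) z = ∫ y in z..(z + (k+1 : ℕ) * H), G y := by
      intro z
      simp only [hI]
      rw [intervalIntegral.mul_integral_comp_add_mul]
      simp
    have hii : ∀ a b, IntervalIntegrable G MeasureTheory.volume a b :=
      fun a b => hc.intervalIntegrable a b
    have hkr : ((k + 1 : ℕ) : ℝ) ≤ r := by exact_mod_cast hk
    have hkH : ((k + 1 : ℕ) : ℝ) * H ≤ r * H := by gcongr
    have hkH0 : 0 ≤ ((k + 1 : ℕ) : ℝ) * H := by positivity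
    have e2 : ((k+1 : ℕ) : ℝ) * (I (k+1) z - I (k+1) z') =
       (∫ y in z..z', G y) - ∫ y in (z + (k+1 : ℕ) * H)..(z' + (k+1 : ℕ) * H), G y := by
      rw [mul_sub, e, e]
      exact intervalIntegral.integral_interval_sub_interval_comm (hii _ _) (hii _ _) (hii _ _)
    have hzd : |z' - z| ≤ 1 := by rw [abs_of_nonneg] <;> linarith
    have b1 : |∫ y in z..z', G y| ≤ K := by
      have := intervalIntegral.norm_integral_le_of_norm_le_const (a := z) (b := z') (C := K)
        (f := G) (by
          intro t ht
          rw [Set.uIoc_of_le hzz] at ht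
          exact hK t ht.1.le (by linarith [ht.2]))
      rw [Real.norm_eq_abs] at this
      nlinarith
    have b2 : |∫ y in (z + (k+1 : ℕ) * H)..(z' + (k+1 : ℕ) * H), G y| ≤ K := by
      have := intervalIntegral.norm_integral_le_of_norm_le_const (a := z + (k+1 : ℕ) * H)
        (b := z' + (k+1 : ℕ) * H) (C := K)
        (f := G) (by
          intro t ht
          rw [Set.uIoc_of_le (by linarith)] at ht
          exact hK t (by linarith [ht.1]) (by linarith [ht.2]))
      rw [Real.norm_eq_abs, add_sub_add_right_eq_sub] at this
      nlinarith
    have hk1 : (1 : ℝ) ≤ ((k + 1 : ℕ) : ℝ) := by push_cast; linarith [(Nat.cast_nonneg k : (0:ℝ) ≤ k)]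
    calc |I (k+1) z - I (k+1) z'| ≤ ((k+1 : ℕ) : ℝ) * |I (k+1) z - I (k+1) z'| :=
          le_mul_of_one_le_left (abs_nonneg _) hk1
      _ = |((k+1 : ℕ) : ℝ) * (I (k+1) z - I (k+1) z')| := by
          rw [abs_mul, abs_of_nonneg (by positivity : (0:ℝ) ≤ ((k+1 : ℕ) : ℝ))]
      _ ≤ 2 * K := by
          rw [e2]
          refine (abs_sub _ _).trans ?_
          linarith
  have hS : |(∑ k ∈ Finset.range r, (-1 : ℝ) ^ (r - (k+1)) * (r.choose (k+1) : ℝ) * I (k+1) z) -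
      ∑ k ∈ Finset.range r, (-1 : ℝ) ^ (r - (k+1)) * (r.choose (k+1) : ℝ) * I (k+1) z'|
      ≤ 2 ^ r * (2 * K) := by
    rw [← Finset.sum_sub_distrib]
    refine (Finset.abs_sum_le_sum_abs _ _).trans ?_
    calc _ ≤ ∑ k ∈ Finset.range r, (r.choose (k+1) : ℝ) * (2 * K) := by
          refine Finset.sum_le_sum ?_
          intro k hk
          rw [← mul_sub, abs_mul, abs_mul, abs_pow]
          simp only [abs_neg, abs_one, one_pow, one_mul, Nat.abs_cast]
          gcongr
          exact hId k (by simpa using hk)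
      _ = (∑ k ∈ Finset.range r, (r.choose (k+1) : ℝ)) * (2 * K) := by rw [Finset.sum_mul]
      _ ≤ _ := by
          gcongr
          have := Nat.sum_range_choose r
          rw [Finset.sum_range_succ'] at this
          have : (∑ k ∈ Finset.range r, r.choose (k+1)) ≤ 2 ^ r := by omega
          exact_mod_cast this
  have h1 := hint z hz (by linarith)
  have h2 := hint z' (by linarith) hz'
  rw [hsum] at h1 h2
  set S := ∑ k ∈ Finset.range r, (-1 : ℝ) ^ (r - (k+1)) * (r.choose (k+1) : ℝ) * I (k+1) z
  set S' := ∑ k ∈ Finset.range r, (-1 : ℝ) ^ (r - (k+1)) * (r.choose (k+1) : ℝ) * I (k+1) z'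
  have h3 : H * |G z - G z'| = |(-1) ^ r * (H * G z) - (-1) ^ r * (H * G z')| := by
    rw [← mul_sub, ← mul_sub, abs_mul, abs_mul, abs_of_pos hH0]; simp
  have h4 : H * |G z - G z'| ≤ ω * H + ω * H + 2 ^ r * (2 * K) := by
    rw [h3]
    rw [abs_le] at *
    constructor <;> linarith [h1.1, h1.2, h2.1, h2.2, hS.1, hS.2]
  have h5 : H * (2 * ω + 2 ^ r * (2 * K) / H) = ω * H + ω * H + 2 ^ r * (2 * K) := by
    field_simp; ring
  rw [← h5] at h4
  exact le_of_mul_le_mul_left h4 hH0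

lemma wt_le {r : ℕ} {H z y : ℝ} (hH : 1 ≤ H) (hyz : |y - z| ≤ r * H + 1) :
    wt r H y ≤ (2 * r + 3) ^ r * wt r H z := by
  unfold wt
  rw [← mul_pow]
  have a1 : |y| ≤ |z| + |y - z| := by
    have := abs_add_le z (y - z); simpa using this
  have a2 : |y - (r - 1)| ≤ |z - (r - 1)| + |y - z| := by
    have := abs_add_le (z - (r - 1)) (y - z)
    have e : z - (r - 1) + (y - z) = y - (r - 1) := by ring
    rwa [e] at this
  gcongr
  have := abs_nonneg z
  have := abs_nonneg (z - (r - 1))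
  have hr : (0 : ℝ) ≤ r := by positivity
  have b1 := mul_nonneg hr (abs_nonneg z)
  have b2 := mul_nonneg hr (abs_nonneg (z - (r - 1)))
  nlinarith

lemma one_le_wt {r : ℕ} {H z : ℝ} (hH : 1 ≤ H) : 1 ≤ wt r H z := by
  unfold wt
  apply one_le_pow₀
  have := abs_nonneg z
  have := abs_nonneg (z - (r - 1))
  linarith

lemma GHyp.fwd {r : ℕ} {H ω α β M : ℝ} {G : ℝ → ℝ} (h : GHyp r H ω α β G) (hω : 0 ≤ ω)
    (hr : 1 ≤ r) (hH1 : 1 ≤ H) (hH : 4 * 2 ^ r * (2 * r + 3) ^ r ≤ H) (hM0 : 0 ≤ M)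
    (hM : ∀ y, α ≤ y → y ≤ β → |G y| ≤ M * wt r H y) {z : ℝ} (hz : α ≤ z)
    (hz' : z + r * H + 1 ≤ β) :
    |G z| ≤ (((2 * r + 3) ^ r + 2) * ω + M / 2) * wt r H z := by
  have hH0 : 0 < H := by linarith
  have hrH : 0 ≤ (r : ℝ) * H := by positivity
  have c1 := Int.le_ceil z
  have c2 := (Int.ceil_lt_add_one z).le
  have h1 := h.int_bound hω hH1 hr ⌈z⌉ (by linarith) (by linarith)
  have hw0 : 0 ≤ wt r H z := by linarith [one_le_wt (r := r) (z := z) hH1]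
  have h2 := h.avg (K := M * ((2 * r + 3) ^ r * wt r H z)) hH1 hz c1 c2 (by linarith)
    (by positivity) (by
      intro y hy hy'
      refine (hM y (by linarith) (by linarith)).trans ?_
      gcongr
      apply wt_le hH1
      rw [abs_of_nonneg] <;> linarith)
  have h3 : wt r H ⌈z⌉ ≤ (2 * r + 3) ^ r * wt r H z := by
    apply wt_le hH1
    rw [abs_of_nonneg] <;> linarith
  have h4 : 2 ^ r * (2 * (M * ((2 * r + 3) ^ r * wt r H z))) / H ≤ M / 2 * wt r H z := by
    rw [div_le_iff₀ hH0]
    have := mul_le_mul_of_nonneg_left hH (mul_nonneg hM0 hw0)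
    linarith
  have h5 : |G z| ≤ |G z - G ⌈z⌉| + |G ⌈z⌉| := by
    have := abs_add_le (G z - G ⌈z⌉) (G ⌈z⌉); simpa using this
  have h6 : wt r H ⌈z⌉ * ω ≤ (2 * r + 3) ^ r * wt r H z * ω := by gcongr
  have h7 : ω * 1 ≤ ω * wt r H z := by gcongr; exact one_le_wt hH1
  linarith

lemma wt_refl {r : ℕ} {H z : ℝ} : wt r H (r - 1 - z) = wt r H z := by
  unfold wt
  congr 1
  have : |(r : ℝ) - 1 - z| = |z - (r - 1)| := by rw [abs_sub_comm]
  rw [this]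
  have : |(r : ℝ) - 1 - z - (r - 1)| = |z| := by rw [← abs_neg]; congr 1; ring
  rw [this]; ring

lemma GHyp.growth {r : ℕ} {H ω α β : ℝ} {G : ℝ → ℝ} (h : GHyp r H ω α β G) (hω : 0 ≤ ω)
    (hr : 1 ≤ r) (hH1 : 1 ≤ H) (hH : 4 * 2 ^ r * (2 * r + 3) ^ r ≤ H)
    (hab : 2 * (r * H + 1) ≤ β - α) {z : ℝ} (hz : α ≤ z) (hz' : z ≤ β) :
    |G z| ≤ 2 * ((2 * r + 3) ^ r + 2) * ω * wt r H z := by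
  have hwc : Continuous (fun z => wt r H z) := by unfold wt; fun_prop
  have hw : ∀ z, 0 < wt r H z := fun z => by linarith [one_le_wt (r := r) (z := z) hH1]
  obtain ⟨m, hm, hmax⟩ := (isCompact_Icc (a := α) (b := β)).exists_isMaxOn ⟨z, hz, hz'⟩
    (f := fun z => |G z| / wt r H z)
    ((h.cont.abs.div hwc (fun z => (hw z).ne')).continuousOn)
  set M := |G m| / wt r H m with hMdef
  have hM0 : 0 ≤ M := div_nonneg (abs_nonneg _) (hw m).le
  have hM : ∀ y, α ≤ y → y ≤ β → |G y| ≤ M * wt r H y := by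
    intro y h1 h2
    have := hmax ⟨h1, h2⟩
    exact (div_le_iff₀ (hw y)).1 this
  have key : |G m| ≤ (((2 * r + 3) ^ r + 2) * ω + M / 2) * wt r H m := by
    by_cases hc : m + r * H + 1 ≤ β
    · exact h.fwd hω hr hH1 hH hM0 hM hm.1 hc
    · have := h.refl.fwd (M := M) (z := r - 1 - m) hω hr hH1 hH hM0 (by
        intro y h1 h2
        have := hM (r - 1 - y) (by linarith) (by linarith)
        rwa [wt_refl] at this) (by linarith [hm.2]) (by linarith [hm.2])
      rw [wt_refl] at this
      simpa using this
  have : M ≤ ((2 * r + 3) ^ r + 2) * ω + M / 2 := (div_le_iff₀ (hw m)).2 key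
  refine (hM z hz hz').trans ?_
  have := (hw z).le
  gcongr
  linarith

lemma fD_poly {r : ℕ} (p : Polynomial ℝ) (hp : p.natDegree < r) (z t : ℝ) :
    fD r (fun y => p.eval y) z t = 0 := by
  have hd : (p.comp (Polynomial.C t * Polynomial.X + Polynomial.C z)).natDegree < r := by
    refine lt_of_le_of_lt Polynomial.natDegree_comp_le ?_
    have : (Polynomial.C t * Polynomial.X + Polynomial.C z).natDegree ≤ 1 :=
      Polynomial.natDegree_linear_le
    nlinarith
  have h := congrFun (Polynomial.fwdDiff_iter_eq_zero_of_degree_lt hd) 0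
  rw [fwdDiff_iter_eq_sum_shift] at h
  unfold fD
  rw [← Pi.zero_apply (M := fun _ : ℝ => ℝ) (0 : ℝ), ← h]
  refine Finset.sum_congr rfl ?_
  intro k _
  simp [mul_comm t, add_comm z]

lemma growth_f (r : ℕ) (hr : 1 ≤ r) : ∃ C : ℝ, 0 ≤ C ∧ ∀ F : ℝ → ℝ, Continuous F →
    ∀ ω δ x : ℝ, 0 ≤ ω → 0 < δ → δ ≤ 2 → x ∈ Set.Icc (-1 : ℝ) 1 →
    (∀ z t, 0 ≤ t → t ≤ δ → -1 ≤ z → z + r * t ≤ 1 → |fD r F z t| ≤ ω) →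
    ∃ p : Polynomial ℝ, p.natDegree < r ∧ ∀ y ∈ Set.Icc (-1 : ℝ) 1,
      |F y - p.eval y| ≤ C * ω * (1 + |y - x| / δ) ^ r := by
  obtain ⟨H, hHdef⟩ : ∃ H : ℝ, H = 4 * 2 ^ r * (2 * r + 3) ^ r := ⟨_, rfl⟩
  have hr' : (1 : ℝ) ≤ r := by exact_mod_cast hr
  have hH1 : 1 ≤ H := by
    rw [hHdef]
    have h1 : (1 : ℝ) ≤ 2 ^ r := one_le_pow₀ (by norm_num)
    have h2 : (1 : ℝ) ≤ (2 * r + 3) ^ r := one_le_pow₀ (by linarith)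
    nlinarith
  have hrH : (r : ℝ) ≤ r * H := le_mul_of_one_le_right (by linarith) hH1
  have hHr : H ≤ r * H := le_mul_of_one_le_left (by linarith) hr'
  obtain ⟨P, hPdef⟩ : ∃ P : ℝ, P = 2 * (r * H + 1) := ⟨_, rfl⟩
  have hP : 0 < P := by rw [hPdef]; positivity
  refine ⟨2 * ((2 * r + 3) ^ r + 2) * (H + 3 * r + 2 * P) ^ r, by positivity, ?_⟩
  intro F hF ω δ x hω hδ hδ2 hx hdiff
  obtain ⟨η, hη⟩ : ∃ η : ℝ, η = δ / P := ⟨_, rfl⟩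
  have hη0 : 0 < η := by rw [hη]; positivity
  have hηP : η * P = δ := by rw [hη]; field_simp
  have hrη : η * (r * H + 1) ≤ 1 := by nlinarith
  have hHη : η * H ≤ δ := by rw [← hηP]; gcongr; rw [hPdef]; linarith
  have hrη1 : η * (r - 1) ≤ 1 := by
    refine le_trans ?_ hrη
    gcongr; linarith
  have hrη0 : 0 ≤ η * (r - 1) := mul_nonneg hη0.le (by linarith)
  obtain ⟨x0, hx0l, hx0r, hx0x⟩ : ∃ x0 : ℝ, -1 ≤ x0 ∧ x0 + η * (r - 1) ≤ 1 ∧ |x - x0| ≤ η * (r - 1) := by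
    by_cases hx0 : x ≤ 0
    · exact ⟨x, hx.1, by linarith, by simpa using hrη0⟩
    · refine ⟨x - η * (r - 1), by linarith, by linarith [hx.2], ?_⟩
      rw [sub_sub_cancel, abs_of_nonneg hrη0]
  have hinj : Set.InjOn (fun i : ℕ => x0 + η * i) (Finset.range r : Finset ℕ) := by
    intro i _ j _ hij
    have : η * (i : ℝ) = η * j := by simpa using hij
    exact_mod_cast mul_left_cancel₀ hη0.ne' this
  set p := Lagrange.interpolate (Finset.range r) (fun i : ℕ => x0 + η * i)
    (fun i : ℕ => F (x0 + η * i)) with hpdef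
  have hpd : p.natDegree < r := by
    have := Lagrange.degree_interpolate_lt (fun i : ℕ => F (x0 + η * i)) hinj
    rw [← hpdef, Finset.card_range] at this
    by_cases hp0 : p = 0
    · rw [hp0]; simp; omega
    · exact (Polynomial.natDegree_lt_iff_degree_lt hp0).2 this
  refine ⟨p, hpd, ?_⟩
  have hG : GHyp r H ω ((-1 - x0) / η) ((1 - x0) / η)
      (fun z => F (x0 + η * z) - p.eval (x0 + η * z)) := by
    refine ⟨?_, ?_, ?_, ?_, ?_⟩
    · have := p.continuous
      fun_prop
    · intro i hi
      have := Lagrange.eval_interpolate_at_node (fun i : ℕ => F (x0 + η * i)) hinj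
        (Finset.mem_range.2 hi)
      beta_reduce at this
      rw [hpdef, this]; ring
    · apply div_nonpos_of_nonpos_of_nonneg <;> linarith
    · rw [le_div_iff₀ hη0]; linarith
    · intro z t ht htH hz hzt
      rw [div_le_iff₀ hη0] at hz
      rw [le_div_iff₀ hη0] at hzt
      have h1 := hdiff (x0 + η * z) (η * t) (by positivity) ((mul_le_mul_of_nonneg_left htH hη0.le).trans hHη)
        (by linarith) (by linarith)
      have h2 := fD_poly p hpd (x0 + η * z) (η * t)
      have h3 : fD r (fun z => F (x0 + η * z) - p.eval (x0 + η * z)) z t =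
          fD r F (x0 + η * z) (η * t) - fD r (fun y => p.eval y) (x0 + η * z) (η * t) := by
        unfold fD
        rw [← Finset.sum_sub_distrib]
        refine Finset.sum_congr rfl ?_
        intro k _
        have e : x0 + η * (z + k * t) = x0 + η * z + k * (η * t) := by ring
        simp only [e]; ring
      rw [h3, h2, sub_zero]; exact h1
  intro y hy
  have hu : x0 + η * ((y - x0) / η) = y := by field_simp; ring
  have hg := hG.growth (z := (y - x0) / η) hω hr hH1 hHdef.ge (by
    rw [← sub_div, le_div_iff₀ hη0]; linarith)
    (by gcongr; exact hy.1) (by gcongr; exact hy.2)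
  simp only [hu] at hg
  refine hg.trans ?_
  obtain ⟨d, hd⟩ : ∃ d : ℝ, d = |y - x| / δ := ⟨_, rfl⟩
  have hd0 : 0 ≤ d := by rw [hd]; positivity
  have hw : wt r H ((y - x0) / η) ≤ ((H + 3 * r + 2 * P) * (1 + d)) ^ r := by
    unfold wt
    have hu1 : |(y - x0) / η| ≤ P * d + (r - 1) := by
      rw [abs_div, abs_of_pos hη0, div_le_iff₀ hη0]
      have e : P * d * η = |y - x| := by rw [hd, ← hηP]; field_simp
      have : |y - x0| ≤ |y - x| + |x - x0| := abs_sub_le _ _ _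
      nlinarith
    have hu2 : |(y - x0) / η - (r - 1)| ≤ |(y - x0) / η| + (r - 1) := by
      refine (abs_sub _ _).trans ?_
      rw [abs_of_nonneg (by linarith : (0:ℝ) ≤ r - 1)]
    gcongr
    have : 0 ≤ (H + 3 * r) * d := by positivity
    nlinarith
  rw [← hd]
  calc _ ≤ 2 * ((2 * r + 3) ^ r + 2) * ω * ((H + 3 * r + 2 * P) * (1 + d)) ^ r := by gcongr
    _ = _ := by rw [mul_pow]; ring

lemma cheb_induction (d : ℕ) (P : Polynomial ℝ → Prop) (h0 : P 0)
    (hT : ∀ k : ℕ, k ≤ d → P (Polynomial.Chebyshev.T ℝ k))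
    (hadd : ∀ p q, P p → P q → P (p + q)) (hsmul : ∀ (a : ℝ) p, P p → P (a • p))
    (q : Polynomial ℝ) (hq : q.natDegree ≤ d) : P q := by
  let S : Polynomial.Sequence ℝ :=
    ⟨fun i => Polynomial.Chebyshev.T ℝ i, fun i => by simp [Polynomial.Chebyshev.degree_T]⟩
  have hS := S.span_degreeLE (m := d) (fun i _ => by
    exact isUnit_iff_ne_zero.2 (Polynomial.leadingCoeff_ne_zero.2 (S.ne_zero i)))
  have hm : q ∈ Polynomial.degreeLE ℝ (d : WithBot ℕ) :=
    Polynomial.mem_degreeLE.2 (Polynomial.natDegree_le_iff_degree_le.1 hq)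
  rw [← hS] at hm
  clear hq
  induction hm using Submodule.span_induction with
  | mem x hx =>
    obtain ⟨i, hi, rfl⟩ := hx
    exact hT i hi
  | zero => exact h0
  | add x y _ _ hx hy => exact hadd x y hx hy
  | smul a x _ hx => exact hsmul a x hx

lemma odd_int (g : ℝ → ℝ) (hg : ∀ t, g (-t) = -g t) : ∫ t in (-π)..π, g t = 0 := by
  have h := intervalIntegral.integral_comp_neg (a := -π) (b := π) g
  simp only [hg, neg_neg, intervalIntegral.integral_neg] at h
  linarith

lemma int_cos (j : ℤ) : ∫ t in (-π)..π, cos (j * t) = if j = 0 then 2 * π else 0 := by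
  split_ifs with h
  · subst h; simp; ring
  · have hj : (j : ℝ) ≠ 0 := by exact_mod_cast h
    rw [intervalIntegral.integral_comp_mul_left _ hj]
    simp [Real.sin_int_mul_pi]

noncomputable def dirP (A : ℕ) : Polynomial ℝ :=
  ∑ k ∈ Finset.range (2 * A + 1), Polynomial.Chebyshev.T ℝ ((k : ℤ) - A)

lemma dirP_eval (A : ℕ) (t : ℝ) :
    (dirP A).eval (cos t) = ∑ k ∈ Finset.range (2 * A + 1), cos (((k : ℤ) - A : ℤ) * t) := by
  unfold dirP
  rw [Polynomial.eval_finsetSum]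
  simp only [Polynomial.Chebyshev.T_real_cos]

lemma dirP_abs (A : ℕ) (t : ℝ) : |(dirP A).eval (cos t)| ≤ 2 * A + 1 := by
  rw [dirP_eval]
  refine (Finset.abs_sum_le_sum_abs _ _).trans ?_
  refine (Finset.sum_le_sum (fun k _ => Real.abs_cos_le_one _)).trans ?_
  simp

lemma dirP_deg (A : ℕ) : (dirP A).natDegree ≤ A := by
  unfold dirP
  refine Polynomial.natDegree_sum_le_of_forall_le _ _ ?_
  intro k hk
  rw [Polynomial.Chebyshev.natDegree_T]
  have := Finset.mem_range.1 hk
  omega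

lemma dirP_repro (A : ℕ) (q : Polynomial ℝ) (hq : q.natDegree ≤ A) :
    ∫ t in (-π)..π, (dirP A).eval (cos t) * q.eval (cos t) = 2 * π * q.eval 1 := by
  refine cheb_induction A (fun q => ∫ t in (-π)..π, (dirP A).eval (cos t) * q.eval (cos t)
    = 2 * π * q.eval 1) ?_ ?_ ?_ ?_ q hq
  · simp
  · intro j hj
    simp only [dirP_eval, Polynomial.Chebyshev.T_real_cos, Finset.sum_mul]
    have e : ∀ k : ℕ, ∀ t : ℝ, cos (((k : ℤ) - A : ℤ) * t) * cos ((j : ℤ) * t) =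
        (cos ((((k : ℤ) - A + j : ℤ) : ℝ) * t) + cos ((((k : ℤ) - A - j : ℤ) : ℝ) * t)) / 2 := by
      intro k t
      push_cast
      rw [add_mul _ (j : ℝ) t, sub_mul _ (j : ℝ) t, cos_add, cos_sub]
      ring
    simp only [e]
    rw [intervalIntegral.integral_finsetSum
      (fun k _ => by apply Continuous.intervalIntegrable; fun_prop)]
    have e2 : ∀ k : ℕ, ∫ t in (-π)..π, (cos ((((k : ℤ) - A + j : ℤ) : ℝ) * t)
        + cos ((((k : ℤ) - A - j : ℤ) : ℝ) * t)) / 2 =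
        (if k = A - j then π else 0) + (if k = A + j then π else 0) := by
      intro k
      rw [intervalIntegral.integral_div, intervalIntegral.integral_add
        (by apply Continuous.intervalIntegrable; fun_prop)
        (by apply Continuous.intervalIntegrable; fun_prop), int_cos, int_cos]
      have c1 : ((k : ℤ) - A + j = 0) ↔ k = A - j := by omega
      have c2 : ((k : ℤ) - A - j = 0) ↔ k = A + j := by omega
      simp only [c1, c2]
      split_ifs <;> ring
    simp only [e2, Finset.sum_add_distrib, Finset.sum_ite_eq', Finset.mem_range]
    rw [if_pos (by omega), if_pos (by omega)]
    simp; ring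
  · intro p q hp hq
    simp only [Polynomial.eval_add, mul_add]
    rw [intervalIntegral.integral_add, hp, hq]
    · apply Continuous.intervalIntegrable; fun_prop
    · apply Continuous.intervalIntegrable; fun_prop
  · intro a p hp
    simp only [Polynomial.eval_smul, smul_eq_mul, mul_left_comm _ a]
    rw [intervalIntegral.integral_const_mul, hp]

noncomputable def fejP (m : ℕ) : Polynomial ℝ :=
  ((1 : ℝ) / (m : ℝ) ^ 2) • ∑ i ∈ Finset.range m, ∑ j ∈ Finset.range m,
    Polynomial.Chebyshev.T ℝ ((i : ℤ) - j)

lemma fejP_deg (m : ℕ) : (fejP m).natDegree ≤ m - 1 := by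
  unfold fejP
  refine (Polynomial.natDegree_smul_le _ _).trans ?_
  refine Polynomial.natDegree_sum_le_of_forall_le _ _ ?_
  intro i hi
  refine Polynomial.natDegree_sum_le_of_forall_le _ _ ?_
  intro j hj
  rw [Polynomial.Chebyshev.natDegree_T]
  have := Finset.mem_range.1 hi
  have := Finset.mem_range.1 hj
  omega

lemma fejP_one (m : ℕ) (hm : 1 ≤ m) : (fejP m).eval 1 = 1 := by
  have : (m : ℝ) ≠ 0 := by positivity
  unfold fejP
  simp [Polynomial.eval_finsetSum]
  field_simp

lemma fejP_eval (m : ℕ) (t : ℝ) : (fejP m).eval (cos t) =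
    ((1 : ℝ) / (m : ℝ) ^ 2) *
      ‖∑ i ∈ Finset.range m, Complex.exp (Complex.I * t) ^ i‖ ^ 2 := by
  have e : ∀ i : ℕ, Complex.exp (Complex.I * t) ^ i
      = ((cos (i * t) : ℝ) : ℂ) + ((sin (i * t) : ℝ) : ℂ) * Complex.I := by
    intro i
    rw [← Complex.exp_nat_mul, ← mul_assoc, mul_comm _ Complex.I, mul_assoc, mul_comm Complex.I,
      Complex.exp_mul_I]
    push_cast
    rfl
  rw [← Complex.normSq_eq_norm_sq, Complex.normSq_apply]
  simp only [e, Complex.re_sum, Complex.im_sum]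
  simp only [Complex.add_re, Complex.add_im, Complex.mul_re, Complex.mul_im, Complex.ofReal_re,
    Complex.ofReal_im, Complex.I_re, Complex.I_im]
  unfold fejP
  rw [Polynomial.eval_smul, smul_eq_mul]
  congr 1
  simp only [Polynomial.eval_finsetSum, Polynomial.Chebyshev.T_real_cos]
  rw [Finset.sum_mul_sum, Finset.sum_mul_sum, ← Finset.sum_add_distrib]
  refine Finset.sum_congr rfl fun i _ => ?_
  rw [← Finset.sum_add_distrib]
  refine Finset.sum_congr rfl fun j _ => ?_
  push_cast
  rw [sub_mul, cos_sub]
  ring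

lemma fejP_nonneg (m : ℕ) (t : ℝ) : 0 ≤ (fejP m).eval (cos t) := by
  rw [fejP_eval]; positivity

lemma fejP_bound (m : ℕ) (hm : 1 ≤ m) (t : ℝ) (ht : |t| ≤ π) :
    (fejP m).eval (cos t) ≤ 11 / (1 + (m * t) ^ 2) := by
  have hm0 : (0 : ℝ) < m := by exact_mod_cast hm
  rw [fejP_eval]
  set N := ‖∑ i ∈ Finset.range m, Complex.exp (Complex.I * t) ^ i‖ with hN
  have hN0 : 0 ≤ N := norm_nonneg _
  have hz : ‖Complex.exp (Complex.I * t)‖ = 1 := by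
    rw [mul_comm]; exact Complex.norm_exp_ofReal_mul_I t
  have h1 : N ≤ m := by
    refine (norm_sum_le _ _).trans ?_
    simp [hz]
  have h2 : N * (2 * |t| / π) ≤ 2 := by
    have hg := geom_sum_mul (Complex.exp (Complex.I * t)) m
    have hn := congrArg norm hg
    rw [norm_mul, ← hN, Complex.norm_exp_I_mul_ofReal_sub_one] at hn
    have h3 : ‖Complex.exp (Complex.I * t) ^ m - 1‖ ≤ 2 := by
      refine (norm_sub_le _ _).trans ?_
      rw [norm_pow, hz]; norm_num
    have h4 := Real.mul_abs_le_abs_sin (x := t / 2) (by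
      rw [abs_div, abs_two]; linarith)
    rw [abs_div, abs_two] at h4
    have h5 : 2 * |t| / π ≤ ‖2 * sin (t / 2)‖ := by
      rw [norm_mul, Real.norm_eq_abs, Real.norm_eq_abs, abs_two]
      have : 2 * |t| / π = 2 * (2 / π * (|t| / 2)) := by ring
      rw [this]; gcongr
    calc _ ≤ N * ‖2 * sin (t / 2)‖ := by gcongr
      _ ≤ 2 := by rw [hn]; exact h3
  have h3 : N * |t| ≤ π := by
    have : N * (2 * |t| / π) = N * |t| * (2 / π) := by ring
    rw [this] at h2
    have hpi := Real.pi_pos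
    have : N * |t| * (2 / π) * π = N * |t| * 2 := by field_simp
    nlinarith
  have h4 : (N * |t|) ^ 2 ≤ π ^ 2 := pow_le_pow_left₀ (by positivity) h3 2
  have h5 : N ^ 2 ≤ (m : ℝ) ^ 2 := pow_le_pow_left₀ hN0 h1 2
  have h6 : π ^ 2 ≤ 10 := by
    have := Real.pi_lt_d2
    have := Real.pi_pos
    nlinarith
  rw [le_div_iff₀ (by positivity), one_div, mul_assoc, inv_mul_le_iff₀ (by positivity)]
  rw [mul_pow, sq_abs] at h4
  have : (m : ℝ) ^ 2 * (N ^ 2 * t ^ 2) ≤ (m : ℝ) ^ 2 * 10 := by gcongr; linarith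
  nlinarith

lemma kernel_exists (r : ℕ) (hr : 1 ≤ r) : ∃ C : ℝ, 0 ≤ C ∧ ∀ n : ℕ, r ≤ n →
    ∃ q : Polynomial ℝ, q.natDegree ≤ n ∧
      (∀ p : Polynomial ℝ, p.natDegree < r → ∀ θ : ℝ,
        ∫ t in (-π)..π, p.eval (cos (θ + t)) * q.eval (cos t) = p.eval (cos θ)) ∧
      ∫ t in (-π)..π, (1 + n * |t|) ^ (2 * r) * |q.eval (cos t)| ≤ C := by
  obtain ⟨c, hc⟩ : ∃ c : ℝ, c = 3 * r + 1 := ⟨_, rfl⟩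
  have hc1 : 1 ≤ c := by rw [hc]; linarith [(Nat.cast_nonneg r : (0:ℝ) ≤ r)]
  obtain ⟨E, hE⟩ : ∃ E : ℝ, E = 3 * (2 * c ^ 2) ^ r * 11 ^ (r + 1) * c ^ 2 := ⟨_, rfl⟩
  have hE0 : 0 ≤ E := by rw [hE]; positivity
  refine ⟨E * π, by positivity, ?_⟩
  intro n hn
  have hn0 : (1 : ℝ) ≤ n := by exact_mod_cast hr.trans hn
  obtain ⟨m', hm'⟩ : ∃ m' : ℕ, m' = (n - (r - 1)) / (2 * (r + 1)) := ⟨_, rfl⟩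
  have hdiv1 : 2 * (r + 1) * m' ≤ n - (r - 1) := by rw [hm']; exact Nat.mul_div_le _ _
  have hdiv2 : n - (r - 1) < 2 * (r + 1) * (m' + 1) := by
    rw [hm']; exact Nat.lt_mul_div_succ _ (by omega)
  obtain ⟨B, hB⟩ : ∃ B : ℕ, B = (r + 1) * m' := ⟨_, rfl⟩
  obtain ⟨A, hA⟩ : ∃ A : ℕ, A = B + (r - 1) := ⟨_, rfl⟩
  have hB2 : 2 * B ≤ n - (r - 1) := by rw [hB]; linarith
  have hAB : A + B ≤ n := by omega
  have hnc : (n : ℝ) ≤ c * (m' + 1) := by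
    have : n ≤ (3 * r + 1) * (m' + 1) := by
      have h1 : n < (r - 1) + 2 * (r + 1) * (m' + 1) := by omega
      have h2 : r - 1 ≤ (r - 1) * (m' + 1) := Nat.le_mul_of_pos_right _ (by omega)
      have h3 : (r - 1) * (m' + 1) + 2 * (r + 1) * (m' + 1) = (3 * r + 1) * (m' + 1) := by
        rw [← add_mul]; congr 1; omega
      omega
    rw [hc]; exact_mod_cast this
  obtain ⟨J, hJ⟩ : ∃ J : Polynomial ℝ, J = fejP (m' + 1) ^ (r + 1) := ⟨_, rfl⟩
  have hJd : J.natDegree ≤ B := by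
    rw [hJ, hB]
    refine Polynomial.natDegree_pow_le.trans ?_
    exact Nat.mul_le_mul_left _ (fejP_deg (m' + 1))
  have hJ1 : J.eval 1 = 1 := by rw [hJ, Polynomial.eval_pow, fejP_one _ (by omega)]; simp
  refine ⟨(1 / (2 * π)) • (dirP A * J), ?_, ?_, ?_⟩
  · refine (Polynomial.natDegree_smul_le _ _).trans ?_
    refine Polynomial.natDegree_mul_le.trans ?_
    have := dirP_deg A
    omega
  · intro p hp θ
    have hpi := Real.pi_pos
    refine cheb_induction (r - 1) (fun p => ∫ t in (-π)..π, p.eval (cos (θ + t)) *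
      ((1 / (2 * π)) • (dirP A * J)).eval (cos t) = p.eval (cos θ)) ?_ ?_ ?_ ?_ p (by omega)
    · simp
    · intro k hk
      have h1 := dirP_repro A (J * Polynomial.Chebyshev.T ℝ k) (by
        refine Polynomial.natDegree_mul_le.trans ?_
        rw [Polynomial.Chebyshev.natDegree_T]
        simp only [Int.natAbs_natCast]
        omega)
      have h2 := odd_int (fun t => (dirP A).eval (cos t) * (J.eval (cos t) * sin (k * t)))
        (by intro t; simp)
      simp only [Polynomial.eval_mul, hJ1, Polynomial.Chebyshev.T_eval_one,
        Polynomial.Chebyshev.T_real_cos] at h1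
      simp only [Polynomial.eval_smul, Polynomial.eval_mul, smul_eq_mul,
        Polynomial.Chebyshev.T_real_cos]
      have e : ∀ t : ℝ, cos ((k : ℤ) * (θ + t)) * (1 / (2 * π) * ((dirP A).eval (cos t) * J.eval (cos t)))
         = (1 / (2 * π) * cos ((k : ℤ) * θ)) * ((dirP A).eval (cos t) * (J.eval (cos t) * cos ((k : ℤ) * t)))
         - (1 / (2 * π) * sin ((k : ℤ) * θ)) * ((dirP A).eval (cos t) * (J.eval (cos t) * sin (k * t))) := by
        intro t
        rw [mul_add, cos_add]
        push_cast
        ring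
      simp only [e]
      rw [intervalIntegral.integral_sub, intervalIntegral.integral_const_mul,
        intervalIntegral.integral_const_mul, h1, h2]
      · field_simp; simp
      · apply Continuous.intervalIntegrable; fun_prop
      · apply Continuous.intervalIntegrable; fun_prop
    · intro p q hp hq
      simp only [Polynomial.eval_add, add_mul]
      rw [intervalIntegral.integral_add, hp, hq]
      · apply Continuous.intervalIntegrable; fun_prop
      · apply Continuous.intervalIntegrable; fun_prop
    · intro a p hp
      simp only [Polynomial.eval_smul a, smul_eq_mul a, mul_assoc a]
      rw [intervalIntegral.integral_const_mul, hp]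
  · have hpi := Real.pi_pos
    have hpt : ∀ t ∈ Set.Icc (-π) π,
        (1 + n * |t|) ^ (2 * r) * |((1 / (2 * π)) • (dirP A * J)).eval (cos t)|
          ≤ E * (n * (1 + (n * t) ^ 2)⁻¹) := by
      intro t ht
      rw [Polynomial.eval_smul, Polynomial.eval_mul, smul_eq_mul, hJ, Polynomial.eval_pow]
      have f0 := fejP_nonneg (m' + 1) t
      have f1 := fejP_bound (m' + 1) (by omega) t (abs_le.2 ht)
      push_cast at f1
      set U : ℝ := 1 + ((m' + 1) * t) ^ 2 with hU
      have hU1 : 1 ≤ U := by rw [hU]; linarith [sq_nonneg (((m' : ℝ) + 1) * t)]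
      have hU0 : 0 < U := by linarith
      have f2 := dirP_abs A t
      have hnU : 1 + (n * t) ^ 2 ≤ c ^ 2 * U := by
        have h1 : (n : ℝ) ^ 2 ≤ (c * (m' + 1)) ^ 2 := pow_le_pow_left₀ (by positivity) hnc 2
        have h2 : (n : ℝ) ^ 2 * t ^ 2 ≤ (c * (m' + 1)) ^ 2 * t ^ 2 := by gcongr
        have h3 : (1 : ℝ) ≤ c ^ 2 := one_le_pow₀ hc1
        rw [hU]
        linarith [h2, h3]
      have hA3 : (2 * A + 1 : ℝ) ≤ 3 * n := by
        have : (A : ℝ) ≤ n := by exact_mod_cast (by omega : A ≤ n)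
        linarith
      have hq : (1 + n * |t|) ^ (2 * r) ≤ (2 * c ^ 2) ^ r * U ^ r := by
        rw [pow_mul, ← mul_pow]
        gcongr
        have : (n * |t|) ^ 2 = (n * t) ^ 2 := by rw [mul_pow, mul_pow, sq_abs]
        nlinarith [sq_nonneg (n * |t| - 1)]
      have hinv : U⁻¹ ≤ c ^ 2 * (1 + (n * t) ^ 2)⁻¹ := by
        rw [← div_eq_mul_inv, le_div_iff₀ (by positivity), inv_mul_le_iff₀ hU0]
        linarith
      have habs : |1 / (2 * π) * ((dirP A).eval (cos t) * (fejP (m' + 1)).eval (cos t) ^ (r + 1))|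
          ≤ 1 * ((3 * n) * (11 / U) ^ (r + 1)) := by
        rw [abs_mul, abs_mul, abs_pow, abs_of_nonneg f0]
        have h1 : |1 / (2 * π)| ≤ 1 := by
          rw [abs_of_pos (by positivity), div_le_one (by positivity)]
          linarith [Real.pi_gt_three]
        gcongr
        exact f2.trans hA3
      calc _ ≤ ((2 * c ^ 2) ^ r * U ^ r) * (1 * ((3 * n) * (11 / U) ^ (r + 1))) := by gcongr
        _ = 3 * (2 * c ^ 2) ^ r * 11 ^ (r + 1) * n * U⁻¹ := by
            rw [div_pow]; field_simp; ring
        _ ≤ 3 * (2 * c ^ 2) ^ r * 11 ^ (r + 1) * n * (c ^ 2 * (1 + (n * t) ^ 2)⁻¹) := by gcongr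
        _ = _ := by rw [hE]; ring
    have hcont : Continuous fun t : ℝ => E * (n * (1 + (n * t) ^ 2)⁻¹) := by
      have : ∀ t : ℝ, 1 + (n * t) ^ 2 ≠ 0 := fun t => by positivity
      fun_prop (disch := assumption)
    refine (intervalIntegral.integral_mono_on (by linarith) ?_ ?_ hpt).trans ?_
    · apply Continuous.intervalIntegrable; fun_prop
    · exact hcont.intervalIntegrable _ _
    · rw [intervalIntegral.integral_const_mul, intervalIntegral.integral_const_mul,
        intervalIntegral.mul_integral_comp_mul_left (f := fun x : ℝ => (1 + x ^ 2)⁻¹), integral_inv_one_add_sq]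
      gcongr
      have := Real.arctan_lt_pi_div_two (n * π)
      have := Real.neg_pi_div_two_lt_arctan (n * -π)
      linarith

lemma conv_poly (F : ℝ → ℝ) (hF : Continuous F) (n : ℕ) (q : Polynomial ℝ) (hq : q.natDegree ≤ n) :
    ∃ p : Polynomial ℝ, p.natDegree ≤ n ∧ ∀ θ : ℝ,
      ∫ t in (-π)..π, F (cos (θ + t)) * q.eval (cos t) = p.eval (cos θ) := by
  refine cheb_induction n (fun q => ∃ p : Polynomial ℝ, p.natDegree ≤ n ∧ ∀ θ : ℝ,
      ∫ t in (-π)..π, F (cos (θ + t)) * q.eval (cos t) = p.eval (cos θ)) ?_ ?_ ?_ ?_ q hq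
  · exact ⟨0, by simp, by simp⟩
  · intro k hk
    refine ⟨(∫ u in (-π)..π, F (cos u) * cos (k * u)) • Polynomial.Chebyshev.T ℝ k, ?_, ?_⟩
    · refine (Polynomial.natDegree_smul_le _ _).trans ?_
      rw [Polynomial.Chebyshev.natDegree_T]; simpa using hk
    · intro θ
      rw [Polynomial.eval_smul, smul_eq_mul, Polynomial.Chebyshev.T_real_cos]
      simp only [Polynomial.Chebyshev.T_real_cos]
      have h2 := odd_int (fun t => F (cos t) * sin (k * t)) (by intro t; simp)
      have hper : Function.Periodic (fun u => F (cos u) * cos (k * (u - θ))) (2 * π) := by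
        intro u
        have e : (k : ℝ) * (u + 2 * π - θ) = k * (u - θ) + k * (2 * π) := by ring
        simp only [cos_add_two_pi, e, cos_add_nat_mul_two_pi]
      have h3 := hper.intervalIntegral_add_eq (θ + -π) (-π)
      have e1 : θ + -π + 2 * π = θ + π := by ring
      have e2 : -π + 2 * π = π := by ring
      rw [e1, e2] at h3
      have h4 := intervalIntegral.integral_comp_add_left (a := -π) (b := π)
        (fun u => F (cos u) * cos (k * (u - θ))) θ
      simp only [add_sub_cancel_left] at h4
      push_cast
      rw [h4, h3]
      have e : ∀ u : ℝ, F (cos u) * cos (k * (u - θ)) = cos (k * θ) * (F (cos u) * cos (k * u))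
          + sin (k * θ) * (F (cos u) * sin (k * u)) := by
        intro u
        rw [mul_sub, cos_sub]; ring
      simp only [e]
      rw [intervalIntegral.integral_add, intervalIntegral.integral_const_mul,
        intervalIntegral.integral_const_mul, h2]
      · ring
      · apply Continuous.intervalIntegrable; fun_prop
      · apply Continuous.intervalIntegrable; fun_prop
  · rintro p q ⟨p', hp', hp⟩ ⟨q', hq', hq⟩
    refine ⟨p' + q', Polynomial.natDegree_add_le_of_degree_le hp' hq', fun θ => ?_⟩
    simp only [Polynomial.eval_add, mul_add]
    rw [intervalIntegral.integral_add, hp, hq]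
    · apply Continuous.intervalIntegrable; fun_prop
    · apply Continuous.intervalIntegrable; fun_prop
  · rintro a p ⟨p', hp', hp⟩
    refine ⟨a • p', (Polynomial.natDegree_smul_le _ _).trans hp', fun θ => ?_⟩
    simp only [Polynomial.eval_smul, smul_eq_mul, mul_left_comm _ a]
    rw [intervalIntegral.integral_const_mul, hp]

lemma mem_Icc_of_step {r k : ℕ} (hk : k ≤ r) {z t : ℝ} (ht : 0 ≤ t) (hz : -1 ≤ z)
    (hzt : z + r * t ≤ 1) : z + k * t ∈ Set.Icc (-1 : ℝ) 1 := by
  have h1 : (k : ℝ) * t ≤ r * t := by gcongr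
  have h2 : 0 ≤ (k : ℝ) * t := by positivity
  constructor <;> linarith

lemma fD_le_modulus (r : ℕ) (f : ℝ → ℝ) (hf : ContinuousOn f (Set.Icc (-1 : ℝ) 1)) (δ z t : ℝ)
    (ht : 0 ≤ t) (htδ : t ≤ δ) (hz : -1 ≤ z) (hzt : z + r * t ≤ 1) :
    |fD r f z t| ≤ modulusSmoothnessOn r f δ := by
  obtain ⟨M, hM⟩ := (isCompact_Icc (a := (-1 : ℝ)) (b := 1)).exists_bound_of_continuousOn hf
  unfold modulusSmoothnessOn
  apply le_csSup
  · refine ⟨∑ k ∈ Finset.range (r + 1), (r.choose k : ℝ) * M, ?_⟩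
    rintro v ⟨t, x, ht, _, hx, hxt, rfl⟩
    refine (Finset.abs_sum_le_sum_abs _ _).trans (Finset.sum_le_sum ?_)
    intro k hk
    rw [abs_mul, abs_mul, abs_pow]
    simp only [abs_neg, abs_one, one_pow, one_mul, Nat.abs_cast]
    gcongr
    exact hM _ (mem_Icc_of_step (Nat.lt_succ_iff.1 (Finset.mem_range.1 hk)) ht hx.1 hxt.2)
  · have := mul_nonneg (Nat.cast_nonneg (α := ℝ) r) ht
    exact ⟨t, z, ht, htδ, ⟨hz, by linarith⟩, ⟨by linarith, hzt⟩, rfl⟩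

lemma cos_step (n : ℕ) (hn : 1 ≤ n) (θ t : ℝ) (hs : 0 ≤ sin θ) :
    1 + |cos (θ + t) - cos θ| / (sin θ / n + 1 / n ^ 2) ≤ (1 + n * |t|) ^ 2 := by
  have hn0 : (0 : ℝ) < n := by exact_mod_cast hn
  have hδ : 0 < sin θ / n + 1 / (n : ℝ) ^ 2 := by positivity
  have h1 : |cos (θ + t) - cos θ| ≤ |t| * sin θ + |t| ^ 2 := by
    have e : cos (θ + t) - cos θ = -(cos θ * (1 - cos t)) - sin θ * sin t := by
      rw [cos_add]; ring
    rw [e]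
    refine (abs_sub _ _).trans ?_
    rw [abs_neg, abs_mul, abs_mul, abs_of_nonneg hs,
      abs_of_nonneg (by linarith [cos_le_one t] : 0 ≤ 1 - cos t)]
    have a1 := abs_cos_le_one θ
    have a2 := Real.one_sub_sq_div_two_le_cos (x := t)
    have a3 : |sin t| ≤ |t| := Real.abs_sin_le_abs
    have a4 := cos_le_one t
    have a5 : |cos θ| * (1 - cos t) ≤ 1 * (1 - cos t) := by gcongr
    have a6 : sin θ * |sin t| ≤ sin θ * |t| := by gcongr
    rw [sq_abs]
    nlinarith [sq_nonneg t]
  have h2 : |cos (θ + t) - cos θ| / (sin θ / n + 1 / n ^ 2) ≤ n * |t| + (n * |t|) ^ 2 := by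
    rw [div_le_iff₀ hδ]
    refine h1.trans ?_
    have e : (n * |t| + (n * |t|) ^ 2) * (sin θ / n + 1 / (n : ℝ) ^ 2) =
        |t| * sin θ + |t| ^ 2 + (n * |t| * (1 / (n : ℝ) ^ 2) + (n * |t|) ^ 2 * (sin θ / n)) := by
      field_simp
      ring
    rw [e]
    have : 0 ≤ n * |t| * (1 / (n : ℝ) ^ 2) + (n * |t|) ^ 2 * (sin θ / n) := by positivity
    linarith
  have : 0 ≤ n * |t| := by positivity
  nlinarith

/-- **Brudny, 1974.** For every `r ∈ ℕ` there is `c(r)` such that every continuous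
`f : [−1,1] → ℝ` admits, for each `n ≥ r`, a polynomial `p_n` of degree at most `n` with
`|f(x) − p_n(x)| ≤ c(r)·ω_r(f; δ_n(x))`, where `δ_n(x) = √(1−x²)/n + 1/n²`. -/
theorem brudny_pointwise_approx (r : ℕ) (hr : 1 ≤ r) :
    ∃ c : ℝ, ∀ f : ℝ → ℝ, ContinuousOn f (Set.Icc (-1 : ℝ) 1) →
      ∀ n : ℕ, r ≤ n →
        ∃ p : Polynomial ℝ, p.natDegree ≤ n ∧
          ∀ x ∈ Set.Icc (-1 : ℝ) 1,
            |f x - p.eval x| ≤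
              c * modulusSmoothnessOn r f (Real.sqrt (1 - x ^ 2) / n + 1 / n ^ 2) := by

  obtain ⟨C1, hC1, hgrow⟩ := growth_f r hr
  obtain ⟨C2, hC2, hker⟩ := kernel_exists r hr
  refine ⟨C1 * (1 + C2), ?_⟩
  intro f hf n hn
  obtain ⟨q, hqd, hrep, hmom⟩ := hker n hn
  obtain ⟨F, hFdef⟩ : ∃ F : ℝ → ℝ, F = Set.IccExtend (by norm_num : (-1 : ℝ) ≤ 1)
    ((Set.Icc (-1 : ℝ) 1).domRestrict f) := ⟨_, rfl⟩
  have hF : Continuous F := by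
    rw [hFdef]; exact (continuousOn_iff_continuous_domRestrict.1 hf).Icc_extend'
  have hFf : ∀ y ∈ Set.Icc (-1 : ℝ) 1, F y = f y := by
    intro y hy
    rw [hFdef, Set.IccExtend_of_mem _ _ hy]; rfl
  obtain ⟨P, hPd, hP⟩ := conv_poly F hF n q hqd
  refine ⟨P, hPd, ?_⟩
  intro x hx
  have hn1 : 1 ≤ n := hr.trans hn
  have hn0 : (1 : ℝ) ≤ n := by exact_mod_cast hn1
  obtain ⟨θ, hθ⟩ : ∃ θ, θ = arccos x := ⟨_, rfl⟩
  have hcos : cos θ = x := by rw [hθ]; exact cos_arccos hx.1 hx.2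
  have hsin : sin θ = √(1 - x ^ 2) := by rw [hθ]; exact sin_arccos x
  have hs0 : 0 ≤ sin θ := by rw [hsin]; positivity
  rw [← hsin]
  obtain ⟨δ, hδ⟩ : ∃ δ, δ = sin θ / n + 1 / (n : ℝ) ^ 2 := ⟨_, rfl⟩
  have hδ0 : 0 < δ := by rw [hδ]; positivity
  have hδ2 : δ ≤ 2 := by
    have h1 : sin θ / n ≤ 1 := by
      rw [div_le_one (by linarith)]; linarith [sin_le_one θ]
    have h2 : 1 / (n : ℝ) ^ 2 ≤ 1 := by
      rw [div_le_one (by positivity)]; exact one_le_pow₀ hn0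
    linarith
  rw [← hδ]
  obtain ⟨ω, hω⟩ : ∃ ω, ω = modulusSmoothnessOn r f δ := ⟨_, rfl⟩
  have hω0 : 0 ≤ ω := by
    rw [hω]
    refine (abs_nonneg _).trans (fD_le_modulus r f hf δ 0 0 le_rfl hδ0.le (by norm_num) (by norm_num))
  rw [← hω]
  obtain ⟨p, hpd, hp⟩ := hgrow F hF ω δ x hω0 hδ0 hδ2 hx (by
    intro z t ht htδ hz hzt
    have h := fD_le_modulus r f hf δ z t ht htδ hz hzt
    have e : fD r F z t = fD r f z t := by
      unfold fD
      refine Finset.sum_congr rfl fun k hk => ?_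
      rw [hFf _ (mem_Icc_of_step (Nat.lt_succ_iff.1 (Finset.mem_range.1 hk)) ht hz hzt)]
    rw [e, hω]; exact h)
  have hx0 : |F x - p.eval x| ≤ C1 * ω := by simpa using hp x hx
  have hint : |∫ t in (-π)..π, (F (cos (θ + t)) - p.eval (cos (θ + t))) * q.eval (cos t)|
      ≤ C1 * ω * C2 := by
    have hpi := Real.pi_pos
    refine (intervalIntegral.abs_integral_le_integral_abs (by linarith)).trans ?_
    have hmono : ∫ t in (-π)..π, |(F (cos (θ + t)) - p.eval (cos (θ + t))) * q.eval (cos t)| ≤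
        ∫ t in (-π)..π, C1 * ω * ((1 + n * |t|) ^ (2 * r) * |q.eval (cos t)|) := by
      refine intervalIntegral.integral_mono_on (by linarith) ?_ ?_ ?_
      · apply Continuous.intervalIntegrable; fun_prop
      · apply Continuous.intervalIntegrable; fun_prop
      · intro t _
        rw [abs_mul, ← mul_assoc]
        gcongr
        refine (hp _ ⟨neg_one_le_cos _, cos_le_one _⟩).trans ?_
        gcongr
        rw [pow_mul]
        gcongr
        have := cos_step n hn1 θ t hs0
        rwa [hcos, ← hδ] at this
    refine hmono.trans ?_
    rw [intervalIntegral.integral_const_mul]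
    gcongr
  have heq : P.eval x - p.eval x =
      ∫ t in (-π)..π, (F (cos (θ + t)) - p.eval (cos (θ + t))) * q.eval (cos t) := by
    simp only [sub_mul]
    rw [intervalIntegral.integral_sub, hP, hrep p hpd, hcos]
    · apply Continuous.intervalIntegrable; fun_prop
    · apply Continuous.intervalIntegrable; fun_prop
  rw [← heq] at hint
  rw [← hFf x hx]
  have e : F x - P.eval x = (F x - p.eval x) - (P.eval x - p.eval x) := by ring
  rw [e]
  refine (abs_sub _ _).trans ?_
  linarith
end
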